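/- arXiv:1703.05014 — 3 statements merged into one kernel-verified Lean document; each statement's English description precedes it below -/
import Mathlib

section
/- Every minimal tame topological dynamical system (K;S) with K metrizable and S amenable is uniquely ergodic, i.e., there is exactly one S-invariant regular Borel probability measure on K. -/
open Filter Topology Set MeasureTheory

namespace Stmt5

/-- Left amenability of a semitopological semigroup. -/
def LeftAmenable (S : Type*) [Mul S] [TopologicalSpace S] : Prop :=
  ∃ m : BoundedContinuousFunction S ℝ →ₗ[ℝ] ℝ,
    (∀ f : BoundedContinuousFunction S ℝ, (∀ t, 0 ≤ f t) → 0 ≤ m f) ∧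
    m 1 = 1 ∧
    ∀ (s : S) (f g : BoundedContinuousFunction S ℝ), (∀ t, g t = f (s * t)) → m g = m f

/-- Right amenability of a semitopological semigroup. -/
def RightAmenable (S : Type*) [Mul S] [TopologicalSpace S] : Prop :=
  ∃ m : BoundedContinuousFunction S ℝ →ₗ[ℝ] ℝ,
    (∀ f : BoundedContinuousFunction S ℝ, (∀ t, 0 ≤ f t) → 0 ≤ m f) ∧
    m 1 = 1 ∧
    ∀ (s : S) (f g : BoundedContinuousFunction S ℝ), (∀ t, g t = f (t * s)) → m g = m f

variable {K : Type*} [TopologicalSpace K] [CompactSpace K] [T2Space K]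
  [TopologicalSpace.MetrizableSpace K] [Nonempty K] [MeasurableSpace K] [BorelSpace K]
variable {S : Type*} [Semigroup S] [TopologicalSpace S] [SMul S K]
  [IsScalarTower S S K] [ContinuousSMul S K]

/-- `(K;S)` is tame: every sequence in an orbit `𝒯_S f` of the Koopman
semigroup has a subsequence converging pointwise on `K`. -/
def Tame (K : Type*) [TopologicalSpace K] (S : Type*) [SMul S K] : Prop :=
  ∀ (f : C(K, ℂ)) (u : ℕ → S), ∃ φ : ℕ → ℕ, StrictMono φ ∧
    ∃ g : K → ℂ, ∀ x : K, Tendsto (fun n => f (u (φ n) • x)) atTop (𝓝 (g x))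

/-- `(K;S)` is minimal: there is no nonempty proper closed `S`-invariant
subset of `K`. -/
def Minimal (K : Type*) [TopologicalSpace K] (S : Type*) [SMul S K] : Prop :=
  ∀ C : Set K, IsClosed C → C.Nonempty → (∀ s : S, ∀ x ∈ C, s • x ∈ C) → C = univ

/-- A set of real continuous functions is sequentially tame if every sequence in it has a pointwise
convergent subsequence. -/
def SeqTame {X : Type*} [TopologicalSpace X] (O : Set C(X, ℝ)) : Prop :=
  ∀ u : ℕ → C(X, ℝ), (∀ n, u n ∈ O) → ∃ φ : ℕ → ℕ, StrictMono φ ∧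
    ∃ g : X → ℝ, ∀ x : X, Tendsto (fun n => u (φ n) x) atTop (𝓝 (g x))

theorem totallyBounded_of_forall_exists_subseq_tendsto {Y : Type*} [UniformSpace Y] {s : Set Y}
    (h : ∀ u : ℕ → Y, (∀ n, u n ∈ s) → ∃ φ : ℕ → ℕ, StrictMono φ ∧
      ∃ a, Tendsto (u ∘ φ) atTop (𝓝 a)) : TotallyBounded s := by
  intro V V_in
  contrapose! h
  obtain ⟨u, u_in, hu⟩ : ∃ u : ℕ → Y, (∀ n, u n ∈ s) ∧
      ∀ n m, m < n → u m ∉ UniformSpace.ball (u n) V := by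
    simp only [not_subset, mem_iUnion₂, not_exists, exists_prop] at h
    simpa only [forall_and, forall_mem_image, not_and] using! seq_of_forall_finite_exists h
  refine ⟨u, u_in, fun φ hφ a huφ => ?_⟩
  obtain ⟨N, hN⟩ : ∃ N, ∀ p q, p ≥ N → q ≥ N → (u (φ p), u (φ q)) ∈ V :=
    huφ.cauchySeq.mem_entourage V_in
  exact hu (φ <| N + 1) (φ N) (hφ <| Nat.lt_add_one N) (hN (N + 1) N N.le_succ le_rfl)

/-- A bounded sequentially tame set is totally bounded in `L¹` of every finite measure. -/
theorem SeqTame.totallyBounded_toLp {X : Type*} [TopologicalSpace X] [CompactSpace X]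
    [MeasurableSpace X] [BorelSpace X] [SecondCountableTopologyEither X ℝ]
    {O : Set C(X, ℝ)} (hO : SeqTame O) {M : ℝ} (hM : ∀ f ∈ O, ‖f‖ ≤ M)
    (P : Measure X) [IsFiniteMeasure P] :
    TotallyBounded (ContinuousMap.toLp 1 P ℝ '' O) := by
  apply totallyBounded_of_forall_exists_subseq_tendsto
  intro u hu
  choose v hv hvu using hu
  obtain ⟨φ, hφ, g, hg⟩ := hO v hv
  refine ⟨φ, hφ, ?_⟩
  have hbound : ∀ n x, ‖v (φ n) x‖ ≤ M := fun n x =>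
    ((v (φ n)).norm_coe_le_norm x).trans (hM _ (hv _))
  have hgmeas : AEStronglyMeasurable g P :=
    aestronglyMeasurable_of_tendsto_ae atTop
      (fun n => (v (φ n)).continuous.aestronglyMeasurable) (ae_of_all _ hg)
  have hgL : MemLp g 1 P := MemLp.of_bound hgmeas M <| ae_of_all _ fun x =>
    le_of_tendsto (hg x).norm (Eventually.of_forall fun n => hbound n x)
  refine ⟨hgL.toLp g, ?_⟩
  rw [Lp.tendsto_Lp_iff_tendsto_eLpNorm']
  have key := tendsto_lintegral_norm_of_dominated_convergence (μ := P)
    (F := fun n x => v (φ n) x) (f := g) (bound := fun _ => M)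
    (fun n => (v (φ n)).continuous.aestronglyMeasurable) (integrable_const M).hasFiniteIntegral
    (fun n => ae_of_all _ (hbound n)) (ae_of_all _ hg)
  refine key.congr fun n => ?_
  rw [eLpNorm_one_eq_lintegral_enorm]
  refine lintegral_congr_ae ?_
  filter_upwards [ContinuousMap.coeFn_toLp (𝕜 := ℝ) (p := 1) P (v (φ n)), hgL.coeFn_toLp]
    with x h1 h2
  simp only [Function.comp_apply, Pi.sub_apply, ← hvu, h1, h2, ofReal_norm]

/-- If the `F n` converge on `D` to a function which lies below `a` and above `b` on every
nonempty open set, then some subsequence of `F` is independent at the levels `a` and `b`. -/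
theorem exists_independent_subseq {X : Type*} [TopologicalSpace X] [Nonempty X]
    {F : ℕ → C(X, ℝ)} {h : X → ℝ} {D : Set X}
    (hlim : ∀ x ∈ D, Tendsto (fun n => F n x) atTop (𝓝 (h x))) {a b : ℝ}
    (hlow : ∀ U : Set X, IsOpen U → U.Nonempty → ∃ x ∈ U, x ∈ D ∧ h x < a)
    (hhigh : ∀ U : Set X, IsOpen U → U.Nonempty → ∃ x ∈ U, x ∈ D ∧ b < h x) :
    ∃ φ : ℕ → ℕ, ∀ (N : ℕ) (σ : ℕ → Bool), ∃ x, ∀ i < N,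
      if σ i then b < F (φ i) x else F (φ i) x < a := by
  let Y := {𝒰 : Set (Set X) // 𝒰.Finite ∧ ∀ U ∈ 𝒰, IsOpen U ∧ U.Nonempty}
  have step : ∀ 𝒰 : Y, ∃ n, ∀ U ∈ 𝒰.1,
      (U ∩ {x | b < F n x}).Nonempty ∧ (U ∩ {x | F n x < a}).Nonempty := by
    rintro ⟨𝒰, hfin, h𝒰⟩
    have : ∀ᶠ n in atTop, ∀ U ∈ 𝒰,
        (U ∩ {x | b < F n x}).Nonempty ∧ (U ∩ {x | F n x < a}).Nonempty := by
      rw [eventually_all_finite hfin]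
      intro U hU
      obtain ⟨x, hxU, hxD, hx⟩ := hlow U (h𝒰 U hU).1 (h𝒰 U hU).2
      obtain ⟨y, hyU, hyD, hy⟩ := hhigh U (h𝒰 U hU).1 (h𝒰 U hU).2
      filter_upwards [(hlim x hxD).eventually_lt_const hx,
        (hlim y hyD).eventually_const_lt hy] with n h1 h2
      exact ⟨⟨y, hyU, h2⟩, ⟨x, hxU, h1⟩⟩
    exact this.exists
  choose n hn using step
  let next : Y → Y := fun 𝒰 =>
    ⟨(fun U => U ∩ {x | b < F (n 𝒰) x}) '' 𝒰.1 ∪ (fun U => U ∩ {x | F (n 𝒰) x < a}) '' 𝒰.1,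
      (𝒰.2.1.image _).union (𝒰.2.1.image _), by
        rintro _ (⟨U, hU, rfl⟩ | ⟨U, hU, rfl⟩)
        · exact ⟨(𝒰.2.2 U hU).1.inter (isOpen_lt continuous_const (F _).continuous),
            (hn 𝒰 U hU).1⟩
        · exact ⟨(𝒰.2.2 U hU).1.inter (isOpen_lt (F _).continuous continuous_const),
            (hn 𝒰 U hU).2⟩⟩
  let start : Y := ⟨{univ}, finite_singleton _, by simp⟩
  let 𝒱 : ℕ → Y := fun k => next^[k] start
  have hsucc : ∀ k, 𝒱 (k + 1) = next (𝒱 k) := fun k => Function.iterate_succ_apply' next k start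
  refine ⟨fun k => n (𝒱 k), fun N σ => ?_⟩
  have hmem : {x | ∀ i < N, if σ i then b < F (n (𝒱 i)) x else F (n (𝒱 i)) x < a} ∈ (𝒱 N).1 := by
    induction N with
    | zero =>
      exact mem_singleton_iff.2 (eq_univ_of_forall fun x i hi => absurd hi (Nat.not_lt_zero i))
    | succ N ih =>
      rw [hsucc]
      cases hσ : σ N with
      | true =>
        refine Or.inl ⟨_, ih, ?_⟩
        ext x
        simp only [mem_inter_iff, mem_ofPred_eq, Nat.forall_lt_succ_right, hσ, if_true]
      | false =>
        refine Or.inr ⟨_, ih, ?_⟩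
        ext x
        simp only [mem_inter_iff, mem_ofPred_eq, Nat.forall_lt_succ_right, hσ,
          Bool.false_eq_true, if_false]
  exact ((𝒱 N).2.2 _ hmem).2

/-- An independent sequence is uniformly separated in `L¹` of some probability measure. -/
theorem exists_isProbabilityMeasure_separating {X : Type*} [TopologicalSpace X] [CompactSpace X]
    [T2Space X] [TopologicalSpace.MetrizableSpace X] [MeasurableSpace X] [BorelSpace X]
    {F : ℕ → C(X, ℝ)} {a b : ℝ}
    (hF : ∀ (N : ℕ) (σ : ℕ → Bool), ∃ x, ∀ i < N, if σ i then b < F i x else F i x < a) :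
    ∃ P : Measure X, IsProbabilityMeasure P ∧
      ∀ k l, k ≠ l → (b - a) / 2 ≤ ∫ x, |F k x - F l x| ∂P := by
  have hF' : ∀ (N : ℕ) (σ : Fin N → Bool), ∃ x, ∀ i : Fin N,
      if σ i then b < F i x else F i x < a := fun N σ => by
    obtain ⟨x, hx⟩ := hF N fun i => if h : i < N then σ ⟨i, h⟩ else false
    exact ⟨x, fun i => by simpa using hx i i.2⟩
  choose x hx using hF'
  have hmeas : ∀ N, Measurable (x N) := fun N => measurable_of_finite _
  let Q : ∀ N : ℕ, Measure (Fin N → Bool) := fun N => (PMF.uniformOfFintype _).toMeasure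
  let P : ℕ → ProbabilityMeasure X := fun N =>
    ⟨(Q N).map (x N), Measure.isProbabilityMeasure_map (hmeas N).aemeasurable⟩
  have hsep : ∀ k l, k ≠ l → ∀ N, k < N → l < N →
      (b - a) / 2 ≤ ∫ y, |F k y - F l y| ∂(P N : Measure X) := by
    intro k l hkl N hk hl
    have hcont : Continuous fun y => |F k y - F l y| := by fun_prop
    change _ ≤ ∫ y, |F k y - F l y| ∂((Q N).map (x N))
    rw [integral_map (hmeas N).aemeasurable hcont.aestronglyMeasurable, PMF.integral_eq_sum]
    set G : (Fin N → Bool) → ℝ := fun σ => |F k (x N σ) - F l (x N σ)| with hG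
    let k' : Fin N := ⟨k, hk⟩
    let l' : Fin N := ⟨l, hl⟩
    have hkl' : l' ≠ k' := fun h => hkl (congrArg Fin.val h).symm
    let flip : (Fin N → Bool) → (Fin N → Bool) := fun σ => Function.update σ k' (!σ k')
    have hflip : Function.Involutive flip := fun σ => by simp [flip]
    have hge : ∀ σ, σ k' ≠ σ l' → b - a ≤ G σ := by
      intro σ hσ
      have h1 := hx N σ k'
      have h2 := hx N σ l'
      simp only [hG]
      cases hk1 : σ k' <;> cases hl1 : σ l' <;> simp only [hk1, hl1, k', l'] at h1 h2 hσ
      · exact absurd rfl hσ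
      · simp only [if_true, Bool.false_eq_true, if_false] at h1 h2
        rw [abs_sub_comm]
        exact le_trans (by linarith) (le_abs_self _)
      · simp only [if_true, Bool.false_eq_true, if_false] at h1 h2
        exact le_trans (by linarith) (le_abs_self _)
      · exact absurd rfl hσ
    have hpair : ∀ σ, b - a ≤ G σ + G (flip σ) := by
      intro σ
      by_cases hσ : σ k' = σ l'
      · have h1 : b - a ≤ G (flip σ) := hge _ (by simp [flip, hkl', hσ])
        have h2 : 0 ≤ G σ := abs_nonneg _
        linarith
      · have h1 := hge σ hσ
        have h2 : 0 ≤ G (flip σ) := abs_nonneg _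
        linarith
    have hsum : (Fintype.card (Fin N → Bool) : ℝ) * (b - a) ≤ 2 * ∑ σ, G σ := by
      have h1 : ∑ σ, G (flip σ) = ∑ σ, G σ := Equiv.sum_comp hflip.toPerm G
      calc (Fintype.card (Fin N → Bool) : ℝ) * (b - a) = ∑ _σ : Fin N → Bool, (b - a) := by
            rw [Finset.sum_const, nsmul_eq_mul, Finset.card_univ]
        _ ≤ ∑ σ, (G σ + G (flip σ)) := Finset.sum_le_sum fun σ _ => hpair σ
        _ = 2 * ∑ σ, G σ := by rw [Finset.sum_add_distrib, h1]; ring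
    have hcard : (0 : ℝ) < Fintype.card (Fin N → Bool) := by exact_mod_cast Fintype.card_pos
    have : ∑ σ, ((PMF.uniformOfFintype (Fin N → Bool)) σ).toReal • G σ
        = (Fintype.card (Fin N → Bool) : ℝ)⁻¹ * ∑ σ, G σ := by
      simp [Finset.mul_sum]
    rw [this, ← div_eq_inv_mul, le_div_iff₀ hcard]
    linarith
  obtain ⟨P₀, -, hP₀⟩ := isCompact_univ.ultrafilter_le_nhds
    ((hyperfilter ℕ).map P) (by simp)
  refine ⟨P₀, inferInstance, fun k l hkl => ?_⟩
  have htend : Tendsto P (hyperfilter ℕ) (𝓝 P₀) := hP₀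
  rw [ProbabilityMeasure.tendsto_iff_forall_integral_tendsto] at htend
  refine ge_of_tendsto (htend (BoundedContinuousFunction.mkOfCompact
    ⟨fun y => |F k y - F l y|, by fun_prop⟩)) ?_
  have : ∀ᶠ N in (hyperfilter ℕ : Filter ℕ), k < N ∧ l < N := by
    refine Nat.hyperfilter_le_atTop ?_
    exact (eventually_gt_atTop k).and (eventually_gt_atTop l)
  filter_upwards [this] with N hN
  exact hsep k l hkl N hN.1 hN.2

/-- A pointwise limit of convex combinations from a tame set cannot oscillate between two
levels on every nonempty open set. -/
theorem SeqTame.not_oscillating {X : Type*} [TopologicalSpace X] [CompactSpace X] [T2Space X]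
    [TopologicalSpace.MetrizableSpace X] [Nonempty X] {O : Set C(X, ℝ)} (hO : SeqTame O)
    {M : ℝ} (hM : ∀ f ∈ O, ‖f‖ ≤ M) {F : ℕ → C(X, ℝ)} (hF : ∀ n, F n ∈ convexHull ℝ O)
    {h : X → ℝ} {D : Set X} (hlim : ∀ x ∈ D, Tendsto (fun n => F n x) atTop (𝓝 (h x)))
    {a b : ℝ} (hab : a < b)
    (hlow : ∀ U : Set X, IsOpen U → U.Nonempty → ∃ x ∈ U, x ∈ D ∧ h x < a)
    (hhigh : ∀ U : Set X, IsOpen U → U.Nonempty → ∃ x ∈ U, x ∈ D ∧ b < h x) : False := by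
  borelize X
  obtain ⟨φ, hφ⟩ := exists_independent_subseq hlim hlow hhigh
  obtain ⟨P, hP, hsep⟩ := exists_isProbabilityMeasure_separating (F := F ∘ φ) hφ
  let L := ContinuousMap.toLp (E := ℝ) 1 P ℝ
  have htb : TotallyBounded (L '' convexHull ℝ O) := by
    have himage : L '' convexHull ℝ O = convexHull ℝ (L '' O) := L.toLinearMap.image_convexHull O
    rw [himage]
    exact (hO.totallyBounded_toLp hM P).convexHull
  obtain ⟨t, ht, hcov⟩ := Metric.totallyBounded_iff.1 htb ((b - a) / 4) (by linarith)
  have hy : ∀ n, ∃ y : t, dist (L (F (φ n))) y < (b - a) / 4 := fun n => by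
    have := hcov (mem_image_of_mem L (hF (φ n)))
    simp only [mem_iUnion, Metric.mem_ball, exists_prop] at this
    obtain ⟨y, hy, hd⟩ := this
    exact ⟨⟨y, hy⟩, hd⟩
  choose y hy using hy
  have := ht.to_subtype
  obtain ⟨k, l, hkl, hyy⟩ := Finite.exists_ne_map_eq_of_infinite y
  have h1 : dist (L (F (φ k))) (L (F (φ l))) < (b - a) / 2 := by
    have h2 := hy k
    have h3 := hy l
    rw [← hyy] at h3
    have := dist_triangle_right (L (F (φ k))) (L (F (φ l))) (y k)
    linarith
  have h2 : dist (L (F (φ k))) (L (F (φ l))) = ∫ x, |F (φ k) x - F (φ l) x| ∂P := by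
    rw [dist_eq_norm, ← map_sub, L1.norm_eq_integral_norm]
    refine integral_congr_ae ?_
    filter_upwards [ContinuousMap.coeFn_toLp (𝕜 := ℝ) (p := 1) P (F (φ k) - F (φ l))] with x hx
    rw [hx]
    rfl
  have h3 : (b - a) / 2 ≤ ∫ x, |F (φ k) x - F (φ l) x| ∂P := hsep k l hkl
  linarith

/-- In a minimal system, an almost invariant set of positive measure meets every nonempty open set
in positive measure. -/
theorem Minimal.measure_inter_ne_zero {X S : Type*} [TopologicalSpace X] [CompactSpace X]
    [MeasurableSpace X] [BorelSpace X] [Semigroup S] [Nonempty S] [TopologicalSpace S] [SMul S X]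
    [IsScalarTower S S X] [ContinuousSMul S X] (hmin : Minimal X S) {m : Measure X}
    (hm : ∀ s : S, MeasurePreserving (fun x : X => s • x) m m) {A : Set X} (hA : MeasurableSet A)
    (hinv : ∀ s : S, (fun x => s • x) ⁻¹' A =ᵐ[m] A) (hA₀ : m A ≠ 0) {U : Set X} (hU : IsOpen U)
    (hne : U.Nonempty) : m (U ∩ A) ≠ 0 := by
  have hcov : ∀ x : X, ∃ s : S, s • x ∈ U := by
    by_contra! hx
    obtain ⟨x, hx⟩ := hx
    let C : Set X := {y | y ∉ U ∧ ∀ s : S, s • y ∉ U}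
    have hC : IsClosed C := by
      have hCeq : C = Uᶜ ∩ ⋂ s : S, (fun y => s • y) ⁻¹' Uᶜ := by
        ext y
        simp [C]
      rw [hCeq]
      exact hU.isClosed_compl.inter <| isClosed_iInter fun s =>
        hU.isClosed_compl.preimage (continuous_const_smul s)
    obtain ⟨s₀⟩ := ‹Nonempty S›
    have hCU : C = univ := hmin C hC
      ⟨s₀ • x, hx s₀, fun s => by rw [← smul_assoc]; exact hx _⟩
      fun s y hy => ⟨hy.2 s, fun t => by rw [← smul_assoc]; exact hy.2 _⟩
    obtain ⟨y, hy⟩ := hne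
    exact (hCU.symm ▸ mem_univ y : y ∈ C).1 hy
  obtain ⟨t, ht⟩ := isCompact_univ.elim_finite_subcover (fun s : S => (fun x => s • x) ⁻¹' U)
    (fun s => hU.preimage (continuous_const_smul s))
    fun x _ => mem_iUnion.2 (hcov x)
  intro h0
  refine hA₀ (measure_mono_null (t := ⋃ s ∈ t, (fun x => s • x) ⁻¹' U ∩ A) ?_ ?_)
  · intro x hx
    have := ht (mem_univ x)
    simp only [mem_iUnion, exists_prop] at this ⊢
    obtain ⟨s, hs, hsx⟩ := this
    exact ⟨s, hs, hsx, hx⟩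
  · refine (measure_biUnion_null_iff t.countable_toSet).2 fun s _ => ?_
    have h1 : m ((fun x => s • x) ⁻¹' U ∩ (fun x => s • x) ⁻¹' A) = 0 := by
      rw [← preimage_inter, (hm s).measure_preimage (hU.measurableSet.inter hA).nullMeasurableSet,
        h0]
    rwa [measure_congr ((ae_eq_refl _).inter (hinv s))] at h1

/-- A linear isometry fixes the element of minimal norm of a convex set it maps into itself. -/
theorem apply_eq_self_of_norm_eq_iInf {E : Type*} [NormedAddCommGroup E]
    [InnerProductSpace ℝ E] (T : E →ₗᵢ[ℝ] E) {C : Set E} (hC : Convex ℝ C) (hT : MapsTo T C C)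
    {v : E} (hv : v ∈ C) (hmin : ‖0 - v‖ = ⨅ w : C, ‖0 - (w : E)‖) : T v = v := by
  have h := (norm_eq_iInf_iff_real_inner_le_zero hC hv).1 hmin (T v) (hT hv)
  have h1 : ‖T v - v‖ ^ 2 ≤ 0 := by
    rw [norm_sub_sq_real, T.norm_map]
    rw [zero_sub, inner_neg_left, inner_sub_right, real_inner_self_eq_norm_sq,
      real_inner_comm] at h
    linarith
  have h2 : ‖T v - v‖ = 0 := by nlinarith [norm_nonneg (T v - v)]
  exact sub_eq_zero.1 (norm_eq_zero.1 h2)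

/-- Mean ergodic theorem: some sequence of convex combinations from an invariant set of continuous
functions converges almost everywhere to an almost invariant function. -/
theorem exists_convexHull_tendsto_ae_invariant {X ι : Type*} [TopologicalSpace X] [CompactSpace X]
    [MeasurableSpace X] [BorelSpace X] [SecondCountableTopologyEither X ℝ] {m : Measure X}
    [IsFiniteMeasure m] {τ : ι → C(X, X)} (hτ : ∀ i, MeasurePreserving (τ i) m m)
    {O : Set C(X, ℝ)} (hO : O.Nonempty) (hinv : ∀ f ∈ O, ∀ i, f.comp (τ i) ∈ O) :
    ∃ F : ℕ → C(X, ℝ), (∀ n, F n ∈ convexHull ℝ O) ∧ ∃ h : X → ℝ, Measurable h ∧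
      (∀ᵐ x ∂m, Tendsto (fun n => F n x) atTop (𝓝 (h x))) ∧ ∀ i, h ∘ τ i =ᵐ[m] h := by
  let L := ContinuousMap.toLp (E := ℝ) 2 m ℝ
  let T : ι → Lp ℝ 2 m →ₗᵢ[ℝ] Lp ℝ 2 m := fun i => Lp.compMeasurePreservingₗᵢ ℝ (τ i) (hτ i)
  have hTL : ∀ i f, T i (L f) = L (f.comp (τ i)) := fun i f => by
    apply Lp.ext
    refine (Lp.coeFn_compMeasurePreserving (L f) (hτ i)).trans ?_
    refine ((hτ i).quasiMeasurePreserving.ae_eq_comp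
      (ContinuousMap.coeFn_toLp (𝕜 := ℝ) (p := 2) m f)).trans ?_
    exact (ContinuousMap.coeFn_toLp (𝕜 := ℝ) (p := 2) m (f.comp (τ i))).symm
  let C := closure (L '' convexHull ℝ O)
  have himage : L '' convexHull ℝ O = convexHull ℝ (L '' O) := L.toLinearMap.image_convexHull O
  have hCconv : Convex ℝ C := by
    refine Convex.closure ?_
    rw [himage]
    exact convex_convexHull ℝ _
  have hTC : ∀ i, MapsTo (T i) C C := fun i => by
    refine MapsTo.closure ?_ (T i).continuous
    rw [himage, mapsTo_iff_image_subset]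
    have h1 : T i '' convexHull ℝ (L '' O) = convexHull ℝ (T i '' (L '' O)) :=
      (T i).toLinearMap.image_convexHull _
    rw [h1]
    refine convexHull_mono ?_
    rintro _ ⟨_, ⟨f, hf, rfl⟩, rfl⟩
    exact ⟨_, hinv f hf i, (hTL i f).symm⟩
  obtain ⟨v, hvC, hv⟩ := exists_norm_eq_iInf_of_complete_convex
    ((hO.convexHull.image L).closure) isClosed_closure.isComplete hCconv 0
  obtain ⟨u, hu, hulim⟩ := mem_closure_iff_seq_limit.1 hvC
  choose F hF hFu using hu
  obtain ⟨φ, -, hφ⟩ := (tendstoInMeasure_of_tendsto_Lp hulim).exists_seq_tendsto_ae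
  have hmeas := (Lp.aestronglyMeasurable v).aemeasurable
  refine ⟨fun n => F (φ n), fun n => hF _, hmeas.mk v, hmeas.measurable_mk, ?_, fun i => ?_⟩
  · have h1 : ∀ᵐ x ∂m, ∀ n, u n x = F n x := ae_all_iff.2 fun n => by
      rw [← hFu n]
      exact ContinuousMap.coeFn_toLp (𝕜 := ℝ) (p := 2) m (F n)
    filter_upwards [hφ, h1, hmeas.ae_eq_mk] with x hx h1 h2
    rw [← h2]
    simpa only [h1] using hx
  · have h1 : T i v = v := apply_eq_self_of_norm_eq_iInf (T i) hCconv (hTC i) hvC hv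
    have h2 : (T i v : X → ℝ) =ᵐ[m] v ∘ τ i := Lp.coeFn_compMeasurePreserving v (hτ i)
    rw [h1] at h2
    exact ((hτ i).quasiMeasurePreserving.ae_eq_comp hmeas.ae_eq_mk.symm).trans
      (h2.symm.trans hmeas.ae_eq_mk)

/-- A normalized positive functional on `C(X, ℝ)` is integration against a regular probability
measure. -/
theorem exists_regular_integral_eq {X : Type*} [TopologicalSpace X] [CompactSpace X] [T2Space X]
    [MeasurableSpace X] [BorelSpace X] (Λ : C(X, ℝ) →ₗ[ℝ] ℝ) (hpos : ∀ f, 0 ≤ f → 0 ≤ Λ f)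
    (hone : Λ 1 = 1) :
    ∃ μ : Measure X, μ.Regular ∧ IsProbabilityMeasure μ ∧
      ∀ f : C(X, ℝ), ∫ x, f x ∂μ = Λ f := by
  let Λ' : CompactlySupportedContinuousMap X ℝ →ₚ[ℝ] ℝ := PositiveLinearMap.mk₀
    { toFun := fun f => Λ f.toContinuousMap
      map_add' := fun f g => Λ.map_add f.toContinuousMap g.toContinuousMap
      map_smul' := fun c f => Λ.map_smul c f.toContinuousMap } fun f hf => hpos _ hf
  have hint : ∀ f : C(X, ℝ), ∫ x, f x ∂(RealRMK.rieszMeasure Λ') = Λ f := fun f =>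
    RealRMK.integral_rieszMeasure Λ' (CompactlySupportedContinuousMap.continuousMapEquiv f)
  refine ⟨RealRMK.rieszMeasure Λ', inferInstance, ?_, hint⟩
  have h1 := hint 1
  simp only [ContinuousMap.one_apply, integral_const, smul_eq_mul, mul_one, hone,
    Measure.real] at h1
  exact ⟨(ENNReal.toReal_eq_one_iff _).1 h1⟩

/-- An amenable semigroup acting on a nonempty compact space has an invariant probability
measure. -/
theorem LeftAmenable.exists_invariant_measure {X S : Type*} [TopologicalSpace X] [CompactSpace X]
    [T2Space X] [TopologicalSpace.MetrizableSpace X] [Nonempty X] [MeasurableSpace X]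
    [BorelSpace X] [Semigroup S] [TopologicalSpace S] [SMul S X] [IsScalarTower S S X]
    [ContinuousSMul S X] (hS : LeftAmenable S) :
    ∃ μ : Measure X, μ.Regular ∧ IsProbabilityMeasure μ ∧
      ∀ s : S, Measure.map (fun x => s • x) μ = μ := by
  obtain ⟨M, hpos, hone, hinv⟩ := hS
  obtain ⟨x₀⟩ := ‹Nonempty X›
  let R : C(X, ℝ) → BoundedContinuousFunction S ℝ := fun f =>
    (BoundedContinuousFunction.mkOfCompact f).compContinuous
      ⟨fun s => s • x₀, continuous_id.smul continuous_const⟩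
  have hR : ∀ f s, R f s = f (s • x₀) := fun f s => rfl
  let Λ : C(X, ℝ) →ₗ[ℝ] ℝ :=
    { toFun := fun f => M (R f)
      map_add' := fun f g => by rw [← map_add]; rfl
      map_smul' := fun c f => by rw [← map_smul]; rfl }
  obtain ⟨μ, hreg, hprob, hμ⟩ := exists_regular_integral_eq Λ
    (fun f hf => hpos _ fun s => hf (s • x₀)) hone
  refine ⟨μ, hreg, hprob, fun s => ?_⟩
  have hs : Continuous fun x : X => s • x := continuous_const_smul s
  have := Measure.isProbabilityMeasure_map (μ := μ) hs.aemeasurable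
  refine ext_of_forall_integral_eq_of_IsFiniteMeasure fun f => ?_
  rw [integral_map hs.aemeasurable f.continuous.aestronglyMeasurable]
  refine (hμ (f.toContinuousMap.comp ⟨_, hs⟩)).trans (Eq.trans ?_ (hμ f.toContinuousMap).symm)
  refine hinv s _ _ fun t => ?_
  rw [hR, hR, ← smul_eq_mul, smul_assoc]
  rfl

/-- In a minimal tame system, the integrals of a continuous function against any two invariant
probability measures `μ`, `ν` satisfy `∫ f dν ≤ ∫ f dμ`. -/
theorem Minimal.integral_le_of_tame {X S : Type*} [TopologicalSpace X] [CompactSpace X]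
    [T2Space X] [TopologicalSpace.MetrizableSpace X] [Nonempty X] [MeasurableSpace X]
    [BorelSpace X] [Semigroup S] [Nonempty S] [TopologicalSpace S] [SMul S X]
    [IsScalarTower S S X] [ContinuousSMul S X] (hmin : Minimal X S) (htame : Tame X S)
    {μ ν : Measure X} [IsProbabilityMeasure μ] [IsProbabilityMeasure ν]
    (hμ : ∀ s : S, Measure.map (fun x => s • x) μ = μ)
    (hν : ∀ s : S, Measure.map (fun x => s • x) ν = ν) (f : C(X, ℝ)) :
    ∫ x, f x ∂ν ≤ ∫ x, f x ∂μ := by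
  by_contra! hlt
  let τ : S → C(X, X) := fun s => ⟨fun x => s • x, continuous_const_smul s⟩
  let O : Set C(X, ℝ) := range fun s => f.comp (τ s)
  have hpμ : ∀ s, MeasurePreserving (τ s) μ μ := fun s => ⟨(τ s).continuous.measurable, hμ s⟩
  have hpν : ∀ s, MeasurePreserving (τ s) ν ν := fun s => ⟨(τ s).continuous.measurable, hν s⟩
  have hp : ∀ s, MeasurePreserving (τ s) (μ + ν) (μ + ν) := fun s =>
    ⟨(τ s).continuous.measurable, by
      rw [Measure.map_add _ _ (τ s).continuous.measurable, (hpμ s).map_eq, (hpν s).map_eq]⟩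
  have hO : ∀ g ∈ O, ‖g‖ ≤ ‖f‖ := by
    rintro _ ⟨s, rfl⟩
    exact (ContinuousMap.norm_le _ (norm_nonneg _)).2 fun x => f.norm_coe_le_norm _
  have hOtame : SeqTame O := by
    intro u hu
    choose s hs using hu
    obtain ⟨φ, hφ, g, hg⟩ := htame ⟨fun x => (f x : ℂ), by fun_prop⟩ s
    refine ⟨φ, hφ, fun x => (g x).re, fun x => ?_⟩
    have := (Complex.continuous_re.tendsto _).comp (hg x)
    refine this.congr fun n => ?_
    rw [← hs (φ n)]
    rfl
  have hOinv : ∀ g ∈ O, ∀ s, g.comp (τ s) ∈ O := by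
    rintro _ ⟨t, rfl⟩ s
    refine ⟨t * s, ?_⟩
    ext x
    change f ((t * s) • x) = f (t • s • x)
    rw [← smul_eq_mul, smul_assoc]
  obtain ⟨F, hF, h, hmeas, hlim, hinv⟩ :=
    exists_convexHull_tendsto_ae_invariant hp (range_nonempty _) hOinv
  have hFbound : ∀ n x, ‖F n x‖ ≤ ‖f‖ := fun n x => by
    have h1 : convexHull ℝ O ⊆ Metric.closedBall 0 ‖f‖ :=
      convexHull_min (fun g hg => mem_closedBall_zero_iff.2 (hO g hg)) (convex_closedBall _ _)
    exact ((F n).norm_coe_le_norm x).trans (mem_closedBall_zero_iff.1 (h1 (hF n)))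
  have hintegral : ∀ ρ : Measure X, IsProbabilityMeasure ρ → ρ ≪ μ + ν →
      (∀ s, MeasurePreserving (τ s) ρ ρ) → Integrable h ρ ∧ ∫ x, h x ∂ρ = ∫ x, f x ∂ρ := by
    intro ρ _ hac hρ
    have hlim' := hac.ae_le hlim
    have hi : ∀ g : C(X, ℝ), Integrable g ρ := fun g =>
      Integrable.of_bound g.continuous.aestronglyMeasurable ‖g‖ (ae_of_all _ g.norm_coe_le_norm)
    refine ⟨Integrable.of_bound hmeas.aestronglyMeasurable ‖f‖ ?_, ?_⟩
    · filter_upwards [hlim'] with x hx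
      exact le_of_tendsto hx.norm (Eventually.of_forall fun n => hFbound n x)
    · have h1 : convexHull ℝ O ⊆ {g : C(X, ℝ) | ∫ x, g x ∂ρ = ∫ x, f x ∂ρ} := by
        refine convexHull_min ?_ ?_
        · rintro _ ⟨s, rfl⟩
          have := integral_map (μ := ρ) (hρ s).measurable.aemeasurable
            (f := f) f.continuous.aestronglyMeasurable
          rw [(hρ s).map_eq] at this
          exact this.symm
        · intro g₁ h₁ g₂ h₂ c d _ _ hcd
          simp only [mem_ofPred_eq, ContinuousMap.add_apply, ContinuousMap.smul_apply,
            smul_eq_mul] at h₁ h₂ ⊢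
          rw [integral_add ((hi g₁).const_mul c) ((hi g₂).const_mul d), integral_const_mul,
            integral_const_mul, h₁, h₂, ← add_mul, hcd, one_mul]
      have h2 : Tendsto (fun n => ∫ x, F n x ∂ρ) atTop (𝓝 (∫ x, h x ∂ρ)) :=
        tendsto_integral_of_dominated_convergence (fun _ => ‖f‖)
          (fun n => (F n).continuous.aestronglyMeasurable) (integrable_const _)
          (fun n => ae_of_all _ (hFbound n)) hlim'
      exact tendsto_nhds_unique h2 (tendsto_const_nhds.congr fun n => (h1 (hF n)).symm)
  obtain ⟨hiμ, heμ⟩ := hintegral μ inferInstance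
    (Measure.AbsolutelyContinuous.rfl.add_right ν) hpμ
  obtain ⟨hiν, heν⟩ := hintegral ν inferInstance
    (add_comm ν μ ▸ Measure.AbsolutelyContinuous.rfl.add_right μ) hpν
  obtain ⟨a, ha, hab⟩ := exists_between hlt
  obtain ⟨b, hab, hb⟩ := exists_between hab
  have hmeet : ∀ B : Set ℝ, MeasurableSet B → (μ + ν) (h ⁻¹' B) ≠ 0 →
      ∀ U : Set X, IsOpen U → U.Nonempty →
        ∃ x ∈ U, x ∈ {x | Tendsto (fun n => F n x) atTop (𝓝 (h x))} ∧ h x ∈ B := by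
    intro B hB hB₀ U hU hne
    have hpos := hmin.measure_inter_ne_zero hp (hmeas hB) (fun s => ?_) hB₀ hU hne
    · obtain ⟨x, hx, hxU, hxB⟩ := (frequently_ae_mem_iff.2 hpos).and_eventually hlim |>.exists
        |>.imp fun x hx => (⟨hx.2, hx.1⟩ : _ ∧ _ ∈ U ∩ h ⁻¹' B)
      exact ⟨x, hxU, hx, hxB⟩
    · filter_upwards [hinv s] with x hx
      exact congrArg B hx
  refine hOtame.not_oscillating hO hF (fun x hx => hx) hab (hmeet (Iio a) measurableSet_Iio ?_)
    (hmeet (Ioi b) measurableSet_Ioi ?_)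
  · have h1 := measure_le_integral_pos hiμ
    rw [heμ] at h1
    have h2 : μ (h ⁻¹' Iio a) ≠ 0 :=
      (h1.trans_le (measure_mono fun x (hx : h x ≤ _) => hx.trans_lt ha)).ne'
    simp [h2]
  · have h1 := measure_integral_le_pos hiν
    rw [heν] at h1
    have h2 : ν (h ⁻¹' Ioi b) ≠ 0 :=
      (h1.trans_le (measure_mono fun x (hx : _ ≤ h x) => hb.trans_le hx)).ne'
    simp [h2]

/-- Every minimal tame metric topological dynamical system
`(K;S)` with `S` amenable is uniquely ergodic. -/
theorem minimal_tame_uniquelyErgodic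
    (hleft : ∀ s : S, Continuous fun t : S => s * t)
    (hright : ∀ s : S, Continuous fun t : S => t * s)
    (hamen : LeftAmenable S ∧ RightAmenable S)
    (htame : Tame K S) (hmin : Minimal K S) :
    ∃! μ : Measure K, μ.Regular ∧ IsProbabilityMeasure μ ∧
      ∀ s : S, Measure.map (fun x => s • x) μ = μ := by
  obtain ⟨μ, hreg, hprob, hinv⟩ := hamen.1.exists_invariant_measure (X := K)
  have : Nonempty S := by
    obtain ⟨m, -, hone, -⟩ := hamen.1
    by_contra hS
    have := not_nonempty_iff.1 hS
    have h1 : (1 : BoundedContinuousFunction S ℝ) = 0 := by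
      ext s
      exact isEmptyElim s
    rw [h1, map_zero] at hone
    exact zero_ne_one hone
  refine ⟨μ, ⟨hreg, hprob, hinv⟩, ?_⟩
  rintro ν ⟨-, hprobν, hinvν⟩
  refine ext_of_forall_integral_eq_of_IsFiniteMeasure fun f => ?_
  exact le_antisymm (hmin.integral_le_of_tame htame hinv hinvν f.toContinuousMap)
    (hmin.integral_le_of_tame htame hinvν hinv f.toContinuousMap)

end Stmt5
end

section
/- Let (K;S) be a topological dynamical system with K metrizable. Then (K;S) is tame if and only if the Ellis semigroup E(K;S) is a Fréchet–Urysohn space, i.e., for every subset A ⊆ E(K;S), every point of the closure of A is the limit of a sequence contained in A. -/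
open Filter Topology Set

namespace Stmt7

variable {K : Type*} [TopologicalSpace K] [CompactSpace K] [T2Space K]
  [TopologicalSpace.MetrizableSpace K]
variable {S : Type*} [Semigroup S] [TopologicalSpace S] [SMul S K]
  [IsScalarTower S S K] [ContinuousSMul S K]

/-- `(K;S)` is tame: every sequence in an orbit `𝒯_S f = {f ∘ s : s ∈ S}` of
the Koopman semigroup has a subsequence converging pointwise on `K`. -/
def Tame (K : Type*) [TopologicalSpace K] (S : Type*) [SMul S K] : Prop :=
  ∀ (f : C(K, ℂ)) (u : ℕ → S), ∃ φ : ℕ → ℕ, StrictMono φ ∧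
    ∃ g : K → ℂ, ∀ x : K, Tendsto (fun n => f (u (φ n) • x)) atTop (𝓝 (g x))

/-- The Ellis semigroup `E(K;S)`: the closure of (the image of) `S` in `K^K`
with the product topology. -/
def Ellis (K : Type*) [TopologicalSpace K] (S : Type*) [SMul S K] : Set (K → K) :=
  closure (range fun s : S => fun x : K => s • x)

/-- Every sequence in `G` has a pointwise convergent subsequence, with a limit not necessarily
in `G`. -/
def SeqPrecompact {X : Type*} (G : Set (X → ℝ)) : Prop :=
  ∀ u : ℕ → X → ℝ, (∀ n, u n ∈ G) → ∃ φ : ℕ → ℕ, StrictMono φ ∧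
    ∃ g : X → ℝ, ∀ x, Tendsto (fun n => u (φ n) x) atTop (𝓝 (g x))

theorem exists_isOpen_closure_subset_ediam_le {X : Type*} [MetricSpace X] {V : Set X}
    (hV : IsOpen V) {x : X} (hx : x ∈ V) {ε : ENNReal} (hε : 0 < ε) :
    ∃ W : Set X, IsOpen W ∧ x ∈ W ∧ closure W ⊆ V ∧ Metric.ediam W ≤ ε := by
  obtain ⟨r, hr, hrV⟩ := Metric.isOpen_iff.1 hV x hx
  have hε2 : 0 < ε / 2 := ENNReal.half_pos hε.ne'
  refine ⟨Metric.ball x (r / 2) ∩ Metric.eball x (ε / 2),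
    Metric.isOpen_ball.inter Metric.isOpen_eball,
    ⟨Metric.mem_ball_self (by positivity), Metric.mem_eball_self hε2⟩, ?_, ?_⟩
  · refine (closure_mono inter_subset_left).trans (Metric.closure_ball_subset_closedBall.trans
      ((Metric.closedBall_subset_ball (by linarith)).trans hrV))
  · refine (Metric.ediam_mono inter_subset_right).trans (Metric.ediam_eball_le.trans ?_)
    rw [ENNReal.mul_div_cancel (by simp) (by simp)]

/-- A Cantor scheme argument: a sequentially precompact set of continuous functions on a Polish
space cannot oscillate simultaneously on arbitrary finite families of open sets meeting `C`. -/
theorem SeqPrecompact.not_forall_finite_oscillation {X : Type*} [TopologicalSpace X] [PolishSpace X]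
    {G : Set (X → ℝ)} (hG : SeqPrecompact G) (hcont : ∀ u ∈ G, Continuous u) {C : Set X}
    (hC : C.Nonempty) {a b : ℝ} (hab : a < b)
    (hosc : ∀ 𝒱 : Set (Set X), 𝒱.Finite → (∀ V ∈ 𝒱, IsOpen V ∧ (V ∩ C).Nonempty) →
      ∃ u ∈ G, ∀ V ∈ 𝒱, (∃ x ∈ V ∩ C, u x < a) ∧ ∃ y ∈ V ∩ C, b < u y) : False := by
  let := TopologicalSpace.upgradeIsCompletelyMetrizable X
  have step : ∀ (k : ℕ) (W : {W : List Bool → Set X // ∀ l, IsOpen (W l) ∧ (W l ∩ C).Nonempty}),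
      ∃ u : G, ∃ W' : {W : List Bool → Set X // ∀ l, IsOpen (W l) ∧ (W l ∩ C).Nonempty},
        ∀ l : List Bool, l.length = k → ∀ c : Bool, closure (W'.1 (c :: l)) ⊆ W.1 l ∧
          Metric.ediam (W'.1 (c :: l)) ≤ (2⁻¹ : ENNReal) ^ k ∧
          ∀ z ∈ W'.1 (c :: l), if c then b < u.1 z else u.1 z < a := by
    rintro k ⟨W, hW⟩
    obtain ⟨u, huG, hu⟩ := hosc (W '' {l | l.length = k}) ((List.finite_length_eq Bool k).image W)
      (by rintro _ ⟨l, -, rfl⟩; exact hW l)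
    have huc := hcont u huG
    have key : ∀ (l : List Bool) (c : Bool), ∃ O : Set X, IsOpen O ∧ (O ∩ C).Nonempty ∧
        (l.length = k → closure O ⊆ W l ∧ Metric.ediam O ≤ (2⁻¹ : ENNReal) ^ k ∧
          ∀ z ∈ O, if c then b < u z else u z < a) := by
      intro l c
      by_cases hl : l.length = k
      · have hopen : IsOpen {z | if c then b < u z else u z < a} := by
          cases c
          · simpa using isOpen_lt huc continuous_const
          · simpa using isOpen_lt continuous_const huc
        obtain ⟨z, hz, hzc⟩ : ∃ z ∈ W l ∩ C, if c then b < u z else u z < a := by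
          cases c
          · simpa using (hu (W l) ⟨l, hl, rfl⟩).1
          · simpa using (hu (W l) ⟨l, hl, rfl⟩).2
        obtain ⟨O, hO, hzO, hOV, hd⟩ := exists_isOpen_closure_subset_ediam_le
          ((hW l).1.inter hopen) (x := z) ⟨hz.1, hzc⟩ (ε := (2⁻¹ : ENNReal) ^ k)
          (ENNReal.pow_pos (by simp) k)
        exact ⟨O, hO, ⟨z, hzO, hz.2⟩, fun _ => ⟨hOV.trans inter_subset_left, hd,
          fun y hy => (hOV (subset_closure hy)).2⟩⟩
      · exact ⟨univ, isOpen_univ, by simpa using hC, fun h => absurd h hl⟩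
    choose O hO using key
    refine ⟨⟨u, huG⟩, ⟨fun l => List.casesOn l univ fun c l => O l c, ?_⟩, ?_⟩
    · rintro (_ | ⟨c, l⟩)
      · exact ⟨isOpen_univ, by simpa using hC⟩
      · exact ⟨(hO l c).1, (hO l c).2.1⟩
    · exact fun l hl c => (hO l c).2.2 hl
  choose U next hnext using step
  let W : ℕ → {W : List Bool → Set X // ∀ l, IsOpen (W l) ∧ (W l ∩ C).Nonempty} :=
    fun n => Nat.rec ⟨fun _ => univ, fun _ => ⟨isOpen_univ, by simpa using hC⟩⟩
      (fun k V => next k V) n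
  have hW : ∀ (l : List Bool) (c : Bool), closure ((W (l.length + 1)).1 (c :: l)) ⊆
      (W l.length).1 l ∧ Metric.ediam ((W (l.length + 1)).1 (c :: l)) ≤
        (2⁻¹ : ENNReal) ^ l.length ∧ ∀ z ∈ (W (l.length + 1)).1 (c :: l),
          if c then b < (U l.length (W l.length)).1 z else (U l.length (W l.length)).1 z < a :=
    fun l c => hnext l.length (W l.length) l rfl c
  let A : List Bool → Set X := fun l => (W l.length).1 l
  have hanti : CantorScheme.ClosureAntitone A := fun l c => (hW l c).1
  have hdiam : CantorScheme.VanishingDiam A := by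
    intro x
    rw [← tendsto_add_atTop_iff_nat 1]
    refine tendsto_of_tendsto_of_tendsto_of_le_of_le tendsto_const_nhds
      (ENNReal.tendsto_pow_atTop_nhds_zero_of_lt_one (r := 2⁻¹) (by simp)) (fun _ => zero_le) ?_
    intro n
    simpa [A, PiNat.res_succ, PiNat.res_length] using (hW (PiNat.res x n) (x n)).2.1
  have huniv := hanti.map_of_vanishingDiam hdiam fun l => ((W l.length).2 l).2.mono inter_subset_left
  obtain ⟨φ, hφ, g, hg⟩ := hG (fun n => (U n (W n)).1) fun n => (U n (W n)).2
  classical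
  let α : ℕ → Bool := fun n => decide (∃ j, φ (2 * j) = n)
  have hα : α ∈ (CantorScheme.inducedMap A).1 := huniv ▸ mem_univ α
  let x := (CantorScheme.inducedMap A).2 ⟨α, hα⟩
  have hx : ∀ n, if α n then b < (U n (W n)).1 x else (U n (W n)).1 x < a := by
    intro n
    have h1 := CantorScheme.map_mem ⟨α, hα⟩ (n + 1)
    have := (hW (PiNat.res α n) (α n)).2.2 x h1
    rwa [PiNat.res_length] at this
  have heven : b ≤ g x := by
    refine ge_of_tendsto' ((hg x).comp (tendsto_id.const_mul_atTop' (r := 2) (by simp))) fun j => ?_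
    have := hx (φ (2 * j))
    rw [if_pos (by simp [α])] at this
    exact this.le
  have hodd : g x ≤ a := by
    refine le_of_tendsto' ((hg x).comp (tendsto_atTop_mono (g := fun j => 2 * j + 1)
      (fun j => by simp; omega) tendsto_id)) fun j => ?_
    have := hx (φ (2 * j + 1))
    rw [if_neg] at this
    · exact this.le
    · simp only [α, decide_eq_true_eq, not_exists]
      intro i hi
      have := hφ.injective hi
      omega
  linarith

theorem exists_isClosed_forall_isOpen_inter {X : Type*} [TopologicalSpace X]
    [SecondCountableTopology X] {I : Set X → Prop} (hmono : ∀ s t, s ⊆ t → I t → I s)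
    (hunion : ∀ T : Set (Set X), T.Countable → (∀ s ∈ T, I s) → I (⋃₀ T)) (hX : ¬ I univ) :
    ∃ C : Set X, IsClosed C ∧ C.Nonempty ∧
      ∀ V, IsOpen V → (V ∩ C).Nonempty → ¬ I (V ∩ C) := by
  obtain ⟨T, hTc, hTs, hT⟩ :=
    TopologicalSpace.isOpen_sUnion_countable {V : Set X | IsOpen V ∧ I V} fun _ h => h.1
  have hW : I (⋃₀ {V : Set X | IsOpen V ∧ I V}) := hT ▸ hunion T hTc fun s hs => (hTs hs).2
  refine ⟨(⋃₀ {V : Set X | IsOpen V ∧ I V})ᶜ, (isOpen_sUnion fun _ h => h.1).isClosed_compl,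
    ?_, ?_⟩
  · rw [nonempty_compl]
    intro h
    exact hX (h ▸ hW)
  · rintro V hV ⟨x, hxV, hxC⟩ hI
    refine hxC ⟨V, ⟨hV, ?_⟩, hxV⟩
    refine hmono _ _ ?_ (hunion {V ∩ (⋃₀ {V : Set X | IsOpen V ∧ I V})ᶜ,
      ⋃₀ {V : Set X | IsOpen V ∧ I V}} (by simp) ?_)
    · intro y hy
      by_cases hyW : y ∈ ⋃₀ {V : Set X | IsOpen V ∧ I V}
      · exact ⟨_, Or.inr rfl, hyW⟩
      · exact ⟨_, Or.inl rfl, hy, hyW⟩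
    · rintro s (rfl | rfl)
      exacts [hI, hW]

theorem SeqPrecompact.measurable_of_mem_closure {X : Type*} [TopologicalSpace X] [PolishSpace X]
    [MeasurableSpace X] [BorelSpace X] {G : Set (X → ℝ)} (hG : SeqPrecompact G)
    (hcont : ∀ u ∈ G, Continuous u) {q : X → ℝ} (hq : q ∈ closure G) : Measurable q := by
  have sep : ∀ a b : ℝ, a < b →
      ∃ B : Set X, MeasurableSet B ∧ (∀ x, b < q x → x ∈ B) ∧ ∀ x ∈ B, a ≤ q x := by
    intro a b hab
    let I : Set X → Prop := fun Y =>
      ∃ B : Set X, MeasurableSet B ∧ (∀ x ∈ Y, b < q x → x ∈ B) ∧ ∀ x ∈ B, a ≤ q x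
    by_cases hI : I univ
    · obtain ⟨B, hB, h1, h2⟩ := hI
      exact ⟨B, hB, fun x => h1 x (mem_univ x), h2⟩
    exfalso
    obtain ⟨C, hCc, hC, hV⟩ := exists_isClosed_forall_isOpen_inter (I := I)
      (fun s t hst ⟨B, hB, h1, h2⟩ => ⟨B, hB, fun x hx => h1 x (hst hx), h2⟩) (by
        intro T hT h
        choose! B hB h1 h2 using h
        refine ⟨⋃ s ∈ T, B s, .biUnion hT hB, ?_, ?_⟩
        · rintro x ⟨s, hs, hx⟩ hbx
          exact mem_biUnion hs (h1 s hs x hx hbx)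
        · intro x hx
          obtain ⟨s, hs, hx⟩ := mem_iUnion₂.1 hx
          exact h2 s hs x hx) hI
    refine hG.not_forall_finite_oscillation hcont hC hab fun 𝒱 hfin h𝒱 => ?_
    have hpt : ∀ V ∈ 𝒱, (∃ x ∈ V ∩ C, q x < a) ∧ ∃ y ∈ V ∩ C, b < q y := by
      intro V hVm
      obtain ⟨hVo, hVn⟩ := h𝒱 V hVm
      have hnot := hV V hVo hVn
      constructor
      · by_contra! h
        exact hnot ⟨V ∩ C, hVo.measurableSet.inter hCc.measurableSet, fun x hx _ => hx, h⟩
      · by_contra! h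
        exact hnot ⟨∅, .empty, fun x hx hb => absurd hb (h x hx).not_gt, by simp⟩
    have hev : ∀ᶠ u in 𝓝 q, ∀ V ∈ 𝒱, (∃ x ∈ V ∩ C, u x < a) ∧ ∃ y ∈ V ∩ C, b < u y := by
      refine hfin.eventually_all.2 fun V hVm => ?_
      obtain ⟨⟨x, hx, hxa⟩, y, hy, hyb⟩ := hpt V hVm
      filter_upwards [(continuous_apply x).continuousAt.eventually_lt_const hxa,
        (continuous_apply y).continuousAt.eventually_const_lt hyb] with u h1 h2
      exact ⟨⟨x, hx, h1⟩, y, hy, h2⟩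
    obtain ⟨u, huG, hu⟩ := ((mem_closure_iff_frequently.1 hq).and_eventually hev).exists
    exact ⟨u, huG, hu⟩
  refine measurable_of_Ioi fun b => ?_
  obtain ⟨c, -, hcb, hc⟩ := exists_seq_strictAnti_tendsto b
  obtain ⟨d, hd⟩ : ∃ d : ℕ → ℝ, ∀ n, b < d n ∧ d n < c n :=
    ⟨fun n => (b + c n) / 2, fun n => ⟨by linarith [hcb n], by linarith [hcb n]⟩⟩
  choose B hB h1 h2 using fun n => sep (d n) (c n) (hd n).2
  have : q ⁻¹' Ioi b = ⋃ n, B n := by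
    ext x
    simp only [mem_preimage, mem_Ioi, mem_iUnion]
    constructor
    · intro hx
      obtain ⟨n, hn⟩ := (hc.eventually_lt_const hx).exists
      exact ⟨n, h1 n x hn⟩
    · rintro ⟨n, hn⟩
      exact (hd n).1.trans_le (h2 n x hn)
  rw [this]
  exact .iUnion hB

/-- A quantitative form of bisequentiality of the pointwise closure of a sequentially precompact
set of continuous functions. -/
theorem SeqPrecompact.exists_isCountablyGenerated {X : Type*} [TopologicalSpace X] [PolishSpace X]
    {G : Set (X → ℝ)} (hG : SeqPrecompact G) (hcont : ∀ u ∈ G, Continuous u)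
    {q : X → ℝ} {L : Ultrafilter (X → ℝ)} (hL : ↑L ≤ 𝓝 q) (hGL : closure G ∈ L)
    {ε : ℝ} (hε : 0 < ε) :
    ∃ M : Filter (X → ℝ), M.IsCountablyGenerated ∧ ↑L ≤ M ∧
      ∀ x, ∀ᶠ h in M, |h x - q x| ≤ ε := by
  borelize X
  have hq : q ∈ closure G :=
    isClosed_closure.mem_of_tendsto (f := id) (b := (L : Filter (X → ℝ))) hL hGL
  obtain ⟨t, hle, hqc, hpol⟩ :=
    (hG.measurable_of_mem_closure hcont hq).exists_continuous
  replace hcont : ∀ u ∈ G, Continuous[t, _] u := fun u hu => continuous_le_dom hle (hcont u hu)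
  clear hq
  clear * - hG hcont hL hGL hε hqc hpol
  let := t
  let I : Set X → Prop := fun Y => ∃ M : Filter (X → ℝ), M.IsCountablyGenerated ∧ ↑L ≤ M ∧
      ∀ x ∈ Y, ∀ᶠ h in M, |h x - q x| ≤ ε
  by_cases hI : I univ
  · obtain ⟨M, h1, h2, h3⟩ := hI
    exact ⟨M, h1, h2, fun x => h3 x (mem_univ x)⟩
  exfalso
  obtain ⟨C, -, hC, hV⟩ := exists_isClosed_forall_isOpen_inter (I := I)
    (fun s t hst ⟨M, h1, h2, h3⟩ => ⟨M, h1, h2, fun x hx => h3 x (hst hx)⟩) (by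
      intro T hT h
      choose M h1 h2 h3 using fun s : T => h s s.2
      have := hT.to_subtype
      refine ⟨⨅ s, M s, inferInstance, le_iInf h2, ?_⟩
      rintro x ⟨s, hs, hx⟩
      exact (h3 ⟨s, hs⟩ x hx).filter_mono (iInf_le _ _)) hI
  have hG' : SeqPrecompact ((fun (g : X → ℝ) x => |g x - q x|) '' G) := by
    intro u hu
    choose v hvG hv using hu
    obtain ⟨φ, hφ, g, hg⟩ := hG v hvG
    refine ⟨φ, hφ, fun x => |g x - q x|, fun x => ?_⟩
    simp only [← hv]
    exact ((hg x).sub_const _).abs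
  refine hG'.not_forall_finite_oscillation (a := ε / 2) (b := ε) ?_ hC (by linarith) ?_
  · rintro _ ⟨g, hg, rfl⟩
    exact ((hcont g hg).sub hqc).abs
  intro 𝒱 hfin h𝒱
  have happly : ∀ x, Continuous fun h : X → ℝ => |h x - q x| := fun x => by fun_prop
  have hevL : ∀ᶠ h in (L : Filter (X → ℝ)), ∀ V ∈ 𝒱,
      (∃ x ∈ V ∩ C, |h x - q x| < ε / 2) ∧ ∃ y ∈ V ∩ C, ε < |h y - q y| := by
    refine hfin.eventually_all.2 fun V hVm => ?_
    obtain ⟨hVo, hVn⟩ := h𝒱 V hVm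
    refine Eventually.and ?_ ?_
    · obtain ⟨x, hx⟩ := hVn
      filter_upwards [hL ((happly x).continuousAt.eventually_lt_const
        (show |q x - q x| < ε / 2 by simpa using hε))] with h hh
      exact ⟨x, hx, hh⟩
    · by_contra hcon
      have hcon' := Ultrafilter.eventually_not.2 hcon
      refine hV V hVo hVn ⟨𝓟 {h | ∀ y ∈ V ∩ C, |h y - q y| ≤ ε}, inferInstance, ?_, ?_⟩
      · rw [le_principal_iff]
        filter_upwards [hcon'] with h hh y hy
        by_contra! hlt
        exact hh ⟨y, hy, hlt⟩
      · exact fun x hx => mem_principal.2 fun h hh => hh x hx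
  obtain ⟨h, hhG, hh⟩ := (Filter.Eventually.and hGL hevL).exists
  have hev : ∀ᶠ u in 𝓝 h, ∀ V ∈ 𝒱,
      (∃ x ∈ V ∩ C, |u x - q x| < ε / 2) ∧ ∃ y ∈ V ∩ C, ε < |u y - q y| := by
    refine hfin.eventually_all.2 fun V hVm => ?_
    obtain ⟨⟨x, hx, hxa⟩, y, hy, hyb⟩ := hh V hVm
    filter_upwards [(happly x).continuousAt.eventually_lt_const hxa,
      (happly y).continuousAt.eventually_const_lt hyb] with u h1 h2
    exact ⟨⟨x, hx, h1⟩, y, hy, h2⟩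
  obtain ⟨u, huG, hu⟩ := ((mem_closure_iff_frequently.1 hhG).and_eventually hev).exists
  exact ⟨_, ⟨u, huG, rfl⟩, hu⟩

theorem tendsto_of_forall_dist_denseSeq {X : Type*} [MetricSpace X]
    [TopologicalSpace.SeparableSpace X] [Nonempty X] {ι : Type*} {l : Filter ι} {u : ι → X} {p : X}
    (h : ∀ i, Tendsto (fun n => dist (u n) (TopologicalSpace.denseSeq X i)) l
      (𝓝 (dist p (TopologicalSpace.denseSeq X i)))) : Tendsto u l (𝓝 p) := by
  rw [Metric.tendsto_nhds]
  intro ε hε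
  obtain ⟨i, hi⟩ := (TopologicalSpace.denseRange_denseSeq X).exists_dist_lt p (half_pos hε)
  filter_upwards [(h i).eventually_lt_const hi] with n hn
  linarith [dist_triangle_right (u n) p (TopologicalSpace.denseSeq X i)]

theorem exists_subseq_tendsto_of_forall_mem_closure {X : Type*} [TopologicalSpace X] [T1Space X]
    {v : ℕ → X} {p : X} (hp : MapClusterPt p atTop v)
    (hseq : ∀ A ⊆ range v, p ∈ closure A → ∃ w : ℕ → X, (∀ n, w n ∈ A) ∧ Tendsto w atTop (𝓝 p)) :
    ∃ φ : ℕ → ℕ, StrictMono φ ∧ Tendsto (v ∘ φ) atTop (𝓝 p) := by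
  by_cases hfreq : ∃ᶠ n in atTop, v n = p
  · obtain ⟨φ, hφ, h⟩ := extraction_of_frequently_atTop hfreq
    exact ⟨φ, hφ, tendsto_const_nhds.congr fun n => (h n).symm⟩
  obtain ⟨N, hN⟩ := eventually_atTop.1 (not_frequently.1 hfreq)
  obtain ⟨w, hw, hwp⟩ := hseq (v '' Ici N) (image_subset_range _ _)
    (hp.mem_closure_of_mem _ (image_mem_map (Ici_mem_atTop N)))
  choose m hmN hm using hw
  have hmt : Tendsto m atTop atTop := by
    refine tendsto_atTop.2 fun k => ?_
    have hk : ∀ i ∈ Ico N k, ∀ᶠ n in atTop, w n ≠ v i := fun i hi =>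
      hwp.eventually_ne (Ne.symm (hN i hi.1))
    filter_upwards [(finite_Ico N k).eventually_all.2 hk] with n hn
    by_contra! hlt
    exact hn (m n) ⟨hmN n, hlt⟩ (hm n).symm
  obtain ⟨φ, hφ, hmφ⟩ := strictMono_subseq_of_tendsto_atTop hmt
  refine ⟨m ∘ φ, hmφ, ?_⟩
  refine (hwp.comp hφ.tendsto_atTop).congr fun n => (hm (φ n)).symm

theorem tame_of_frechetUrysohn {K S : Type*} [TopologicalSpace K] [CompactSpace K] [T1Space K]
    [SMul S K]
    (h : ∀ A : Set (K → K), A ⊆ Ellis K S → ∀ f ∈ closure A,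
      ∃ u : ℕ → K → K, (∀ n, u n ∈ A) ∧ Tendsto u atTop (𝓝 f)) : Tame K S := by
  intro f u
  let v : ℕ → K → K := fun n x => u n • x
  obtain ⟨p, hp⟩ := exists_clusterPt_of_compactSpace (map v atTop)
  obtain ⟨φ, hφ, hlim⟩ := exists_subseq_tendsto_of_forall_mem_closure (v := v) hp fun A hA =>
    h A (hA.trans (range_subset_iff.2 fun n => subset_closure ⟨u n, rfl⟩)) p
  refine ⟨φ, hφ, fun x => f (p x), fun x => ?_⟩
  exact (f.continuous.tendsto _).comp (tendsto_pi_nhds.1 hlim x)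

theorem Tame.seqPrecompact {K S : Type*} [TopologicalSpace K] [SMul S K] (h : Tame K S) {f : K → ℝ} (hf : Continuous f) :
    SeqPrecompact (range fun (s : S) (x : K) => f (s • x)) := by
  intro v hv
  choose u hu using hv
  obtain ⟨φ, hφ, g, hg⟩ := h ⟨fun x => (f x : ℂ), by fun_prop⟩ u
  refine ⟨φ, hφ, fun x => (g x).re, fun x => ?_⟩
  simp only [← hu]
  exact (Complex.continuous_re.tendsto _).comp (hg x)

theorem Tame.exists_seq_tendsto {K S : Type*} [TopologicalSpace K] [CompactSpace K]
    [TopologicalSpace.MetrizableSpace K] [SMul S K] [ContinuousConstSMul S K] (htame : Tame K S) {A : Set (K → K)} (hA : A ⊆ Ellis K S)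
    {q : K → K} (hq : q ∈ closure A) :
    ∃ u : ℕ → K → K, (∀ n, u n ∈ A) ∧ Tendsto u atTop (𝓝 q) := by
  let := TopologicalSpace.metrizableSpaceMetric K
  obtain hK | hK := isEmpty_or_nonempty K
  · obtain ⟨p, hp⟩ := closure_nonempty_iff.1 ⟨q, hq⟩
    exact ⟨fun _ => p, fun _ => hp, by rw [Subsingleton.elim q p]; exact tendsto_const_nhds⟩
  obtain ⟨L, hAL, hLq⟩ := mem_closure_iff_ultrafilter.1 hq
  let F : ℕ → K → ℝ := fun i x => dist x (TopologicalSpace.denseSeq K i)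
  have hF : ∀ i, Continuous (F i) := fun i => by fun_prop
  have hcomp : ∀ i, Continuous fun (h : K → K) x => F i (h x) := fun i =>
    continuous_pi fun x => (hF i).comp (continuous_apply x)
  have main : ∀ i m : ℕ, ∃ M : Filter (K → K), M.IsCountablyGenerated ∧ ↑L ≤ M ∧
      ∀ x, ∀ᶠ h in M, |F i (h x) - F i (q x)| ≤ 1 / ((m : ℝ) + 1) := by
    intro i m
    obtain ⟨M, h1, h2, h3⟩ := (htame.seqPrecompact (hF i)).exists_isCountablyGenerated
      (by
        rintro _ ⟨s, rfl⟩
        exact (hF i).comp (continuous_const_smul s))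
      (q := fun x => F i (q x)) (L := L.map fun h x => F i (h x))
      (by simpa [Tendsto] using ((hcomp i).tendsto q).mono_left hLq)
      (by
        rw [Ultrafilter.mem_map]
        filter_upwards [hAL] with h hh
        refine map_mem_closure (hcomp i) (hA hh) ?_
        rintro _ ⟨s, rfl⟩
        exact ⟨s, rfl⟩)
      (Nat.one_div_pos_of_nat (n := m))
    exact ⟨M.comap fun h x => F i (h x), inferInstance, map_le_iff_le_comap.1 h2,
      fun x => (h3 x).comap _⟩
  choose M h1 h2 h3 using main
  let N : Filter (K → K) := (⨅ i, ⨅ m, M i m) ⊓ 𝓟 A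
  have hLN : ↑L ≤ N := le_inf (le_iInf fun i => le_iInf fun m => h2 i m) (le_principal_iff.2 hAL)
  have : N.NeBot := L.neBot.mono hLN
  obtain ⟨u, hu⟩ := N.exists_seq_tendsto
  obtain ⟨n₀, hn₀⟩ := eventually_atTop.1
    (hu.eventually (show ∀ᶠ h in N, h ∈ A from mem_inf_of_right (mem_principal_self A)))
  refine ⟨fun n => u (n + n₀), fun n => hn₀ _ (Nat.le_add_left _ _), ?_⟩
  refine Tendsto.comp ?_ (tendsto_add_atTop_nat n₀)
  rw [tendsto_pi_nhds]
  refine fun x => tendsto_of_forall_dist_denseSeq fun i => ?_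
  rw [Metric.tendsto_nhds]
  intro ε hε
  obtain ⟨m, hm⟩ := exists_nat_one_div_lt hε
  have hNM : N ≤ M i m := inf_le_left.trans ((iInf_le _ i).trans (iInf_le _ m))
  filter_upwards [hu.eventually ((h3 i m x).filter_mono hNM)] with n hn
  exact hn.trans_lt hm

/-- A metric topological dynamical system `(K;S)` is tame if
and only if its Ellis semigroup is a Fréchet–Urysohn space: every point in the
closure of a subset `A` of `E(K;S)` is the limit of a sequence in `A`. -/
theorem tame_iff_ellis_frechetUrysohn
    (hleft : ∀ s : S, Continuous fun t : S => s * t)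
    (hright : ∀ s : S, Continuous fun t : S => t * s) :
    Tame K S ↔
      ∀ A : Set (K → K), A ⊆ Ellis K S → ∀ f ∈ closure A,
        ∃ u : ℕ → K → K, (∀ n, u n ∈ A) ∧ Tendsto u atTop (𝓝 f) := by
  exact ⟨fun h _ hA _ hf => h.exists_seq_tendsto hA hf, tame_of_frechetUrysohn⟩

end Stmt7
end

section
/- Let (K;S) be a weak* mean ergodic topological dynamical system with S left amenable. Then for every x ∈ K the orbit closure M = cl(Sx) is a nonempty closed S-invariant subset of K, and the subsystem (M;S) is uniquely ergodic: there is exactly one S-invariant regular Borel probability measure on K whose support is contained in M. -/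
open Filter Topology Set MeasureTheory

namespace Stmt19

/-- Left amenability of a semitopological semigroup. -/
def LeftAmenable (S : Type*) [Mul S] [TopologicalSpace S] : Prop :=
  ∃ m : BoundedContinuousFunction S ℝ →ₗ[ℝ] ℝ,
    (∀ f : BoundedContinuousFunction S ℝ, (∀ t, 0 ≤ f t) → 0 ≤ m f) ∧
    m 1 = 1 ∧
    ∀ (s : S) (f g : BoundedContinuousFunction S ℝ), (∀ t, g t = f (s * t)) → m g = m f

variable {K : Type*} [TopologicalSpace K] [CompactSpace K] [T2Space K]
  [MeasurableSpace K] [BorelSpace K]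
variable {S : Type*} [Semigroup S] [TopologicalSpace S] [Nonempty S] [SMul S K]
  [IsScalarTower S S K] [ContinuousSMul S K]

/-- The Koopman operator of `s ∈ S` on `C(K, ℂ)`. -/
noncomputable def koopman (s : S) : C(K, ℂ) →L[ℂ] C(K, ℂ) where
  toFun f := f.comp ⟨fun x => s • x, continuous_const.smul continuous_id⟩
  map_add' f g := by ext x; rfl
  map_smul' c f := by ext x; rfl
  cont := ContinuousMap.continuous_precomp _

/-- The adjoint Koopman operator on the dual `C(K)'`. -/
noncomputable def koopmanDual (s : S) :
    (C(K, ℂ) →L[ℂ] ℂ) → (C(K, ℂ) →L[ℂ] ℂ) :=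
  fun μ => μ.comp (koopman s)

/-- The weak* topology on `C(K)'`. -/
noncomputable def wstarTop (K : Type*) [TopologicalSpace K] [CompactSpace K] :
    TopologicalSpace (C(K, ℂ) →L[ℂ] ℂ) :=
  TopologicalSpace.induced (fun μ (f : C(K, ℂ)) => μ f) inferInstance

/-- The topology of pointwise weak* convergence on maps `C(K)' → C(K)'`. -/
noncomputable def piWstar (K : Type*) [TopologicalSpace K] [CompactSpace K] :
    TopologicalSpace ((C(K, ℂ) →L[ℂ] ℂ) → (C(K, ℂ) →L[ℂ] ℂ)) :=
  @Pi.topologicalSpace _ _ (fun _ => wstarTop K)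

/-- `(K;S)` is weak* mean ergodic. -/
noncomputable def WStarMeanErgodic (K : Type*) [TopologicalSpace K] [CompactSpace K]
    (S : Type*) [Semigroup S] [SMul S K] [IsScalarTower S S K] [TopologicalSpace S]
    [ContinuousSMul S K] : Prop :=
  ∀ {ι : Type*} (l : Filter ι), l.NeBot →
    ∀ R : ι → (C(K, ℂ) →L[ℂ] ℂ) → (C(K, ℂ) →L[ℂ] ℂ),
      (∀ i, R i ∈ @closure _ (piWstar K)
        (convexHull ℝ (range (koopmanDual (K := K) (S := S))))) →
      (∀ (μ : C(K, ℂ) →L[ℂ] ℂ) (s : S),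
        Tendsto (fun i => R i μ - koopmanDual s (R i μ)) l (@nhds _ (wstarTop K) 0)) →
      ∀ μ : C(K, ℂ) →L[ℂ] ℂ, ∃ ν : C(K, ℂ) →L[ℂ] ℂ,
        Tendsto (fun i => R i μ) l (@nhds _ (wstarTop K) ν)

open scoped BoundedContinuousFunction CompactlySupported

/-- A positive normalised functional on a space of functions is a limit of finite convex
combinations of point evaluations. -/
theorem exists_ultrafilter_tendsto_average {X E : Type*} [AddCommGroup E] [Module ℝ E]
    (ev : X → E →ₗ[ℝ] ℝ) (m : E →ₗ[ℝ] ℝ) (one : E) (hev : ∀ x, ev x one = 1) (hm : m one = 1)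
    (hpos : ∀ f, (∀ x, 0 ≤ ev x f) → 0 ≤ m f) :
    ∃ U : Ultrafilter (X →₀ ℝ),
      convexHull ℝ (range fun x => Finsupp.single x (1 : ℝ)) ∈ U ∧
      ∀ f, Tendsto (fun w : X →₀ ℝ => w.sum fun x a => a * ev x f) U (𝓝 (m f)) := by
  classical
  set D : Set (X →₀ ℝ) := convexHull ℝ (range fun x => Finsupp.single x (1 : ℝ)) with hD
  let e : (X →₀ ℝ) →ₗ[ℝ] (E → ℝ) := Finsupp.linearCombination ℝ fun x f => ev x f
  have he : ∀ w f, e w f = w.sum fun x a => a * ev x f := by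
    intro w f
    simp [e, Finsupp.linearCombination_apply, Finsupp.sum, Finset.sum_apply]
  have heD : e '' D = convexHull ℝ (range fun x f => ev x f) := by
    rw [hD, LinearMap.image_convexHull, ← range_comp]
    congr 2
    ext x f
    simp [e]
  have hmem : (fun f => m f) ∈ closure (e '' D) := by
    rw [mem_closure_iff]
    intro o ho hmo
    obtain ⟨I, u, hu, huo⟩ := isOpen_pi_iff.1 ho _ hmo
    let r : (E → ℝ) →ₗ[ℝ] (I → ℝ) := LinearMap.funLeft ℝ ℝ (fun i : I => (i : E))
    have hr : r (fun f => m f) ∈ closure (r '' (e '' D)) := by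
      by_contra hcon
      have hcv : Convex ℝ (closure (r '' (e '' D))) := by
        rw [heD]
        exact ((convex_convexHull ℝ _).linear_image r).closure
      obtain ⟨L, c, hL, hc⟩ := geometric_hahn_banach_closed_point hcv isClosed_closure hcon
      let g : E := ∑ i : I, L (fun j => if i = j then 1 else 0) • (i : E)
      have hLg : ∀ n : E →ₗ[ℝ] ℝ, L (r fun f => n f) = n g := by
        intro n
        have := LinearMap.pi_apply_eq_sum_univ (L : (I → ℝ) →ₗ[ℝ] ℝ) (r fun f => n f)
        simp only [ContinuousLinearMap.coe_coe] at this
        rw [this, map_sum]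
        refine Finset.sum_congr rfl fun i _ => ?_
        rw [map_smul, smul_eq_mul, smul_eq_mul, mul_comm]
        rfl
      have h0 : 0 ≤ m (c • one - g) := by
        refine hpos _ fun x => ?_
        have hx : L (r fun f => ev x f) < c := by
          refine hL _ (subset_closure ⟨_, ?_, rfl⟩)
          rw [heD]
          exact subset_convexHull ℝ _ ⟨x, rfl⟩
        rw [hLg] at hx
        rw [map_sub, map_smul, hev, smul_eq_mul, mul_one]
        linarith
      rw [map_sub, map_smul, hm, smul_eq_mul, mul_one] at h0
      rw [hLg] at hc
      linarith
    have hopen : IsOpen (univ.pi fun i : I => u i) :=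
      isOpen_set_pi finite_univ fun i _ => (hu i i.2).1
    obtain ⟨_, hv, v, hvD, rfl⟩ := mem_closure_iff.1 hr _ hopen fun i _ => (hu i i.2).2
    exact ⟨v, huo fun i hi => hv ⟨i, hi⟩ trivial, hvD⟩
  obtain ⟨V, hDV, hV⟩ := mem_closure_iff_ultrafilter.1 hmem
  refine ⟨Ultrafilter.ofComapInfPrincipal hDV, Ultrafilter.ofComapInfPrincipal_mem hDV, fun f => ?_⟩
  have ht : Tendsto e (Ultrafilter.ofComapInfPrincipal hDV) (𝓝 fun f => m f) := by
    rw [Tendsto, ← Ultrafilter.coe_map, Ultrafilter.ofComapInfPrincipal_eq_of_map]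
    exact hV
  simpa only [he] using tendsto_pi_nhds.1 ht f

section Averages

variable {Y : Type*} [TopologicalSpace Y]

theorem eq_of_forall_re_eq {φ ψ : C(Y, ℂ) →L[ℂ] ℂ} (h : ∀ f, (φ f).re = (ψ f).re) : φ = ψ := by
  ext f
  refine Complex.ext (h f) ?_
  simpa using h ((-Complex.I) • f)

variable {G : Type*} [TopologicalSpace G] [SMul G Y] [ContinuousSMul G Y]

@[simp]
theorem koopmanDual_apply (s : G) (μ : C(Y, ℂ) →L[ℂ] ℂ) (f : C(Y, ℂ)) :
    koopmanDual s μ f = μ (koopman s f) := rfl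

@[simp]
theorem koopman_apply (s : G) (f : C(Y, ℂ)) (y : Y) : koopman s f y = f (s • y) := rfl

theorem koopman_koopman [Semigroup G] [IsScalarTower G G Y] (s t : G) (f : C(Y, ℂ)) :
    koopman s (koopman t f) = koopman (t * s) f := by
  ext y
  simp only [koopman_apply]
  rw [← smul_assoc, smul_eq_mul]

/-- The weighted sum of adjoint Koopman operators. -/
noncomputable def koopmanAverage (w : G →₀ ℝ) : (C(Y, ℂ) →L[ℂ] ℂ) → (C(Y, ℂ) →L[ℂ] ℂ) :=
  Finsupp.linearCombination ℝ (koopmanDual (K := Y) (S := G)) w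

theorem koopmanAverage_apply (w : G →₀ ℝ) (μ : C(Y, ℂ) →L[ℂ] ℂ) (f : C(Y, ℂ)) :
    koopmanAverage w μ f = w.sum fun s a => (a : ℂ) * μ (koopman s f) := by
  simp [koopmanAverage, Finsupp.linearCombination_apply, Finsupp.sum, Finset.sum_apply]

theorem re_koopmanAverage_apply (w : G →₀ ℝ) (μ : C(Y, ℂ) →L[ℂ] ℂ) (f : C(Y, ℂ)) :
    (koopmanAverage w μ f).re = w.sum fun s a => a * (μ (koopman s f)).re := by
  simp [koopmanAverage_apply, Finsupp.sum]

variable (Y G) in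
/-- The convex hull of the adjoint Koopman operators. -/
def koopmanHull : Set ((C(Y, ℂ) →L[ℂ] ℂ) → (C(Y, ℂ) →L[ℂ] ℂ)) :=
  convexHull ℝ (range (koopmanDual (K := Y) (S := G)))

theorem koopmanAverage_mem {w : G →₀ ℝ}
    (hw : w ∈ convexHull ℝ (range fun s => Finsupp.single s (1 : ℝ))) :
    koopmanAverage w ∈ koopmanHull Y G := by
  have h := mem_image_of_mem (Finsupp.linearCombination ℝ (koopmanDual (K := Y) (S := G))) hw
  have hc : (Finsupp.linearCombination ℝ (koopmanDual (K := Y) (S := G)) ∘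
      fun s => Finsupp.single s (1 : ℝ)) = koopmanDual (K := Y) (S := G) :=
    funext fun s => by simp
  rw [LinearMap.image_convexHull, ← range_comp, hc] at h
  exact h

theorem comp_mem_koopmanHull [Semigroup G] [IsScalarTower G G Y]
    {A B : (C(Y, ℂ) →L[ℂ] ℂ) → (C(Y, ℂ) →L[ℂ] ℂ)}
    (hA : A ∈ koopmanHull Y G) (hB : B ∈ koopmanHull Y G) : A ∘ B ∈ koopmanHull Y G := by
  have hleft : ∀ s : G, ∀ B ∈ koopmanHull Y G, koopmanDual s ∘ B ∈ koopmanHull Y G := by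
    intro s B hB
    let L : ((C(Y, ℂ) →L[ℂ] ℂ) → (C(Y, ℂ) →L[ℂ] ℂ)) →ₗ[ℝ]
        ((C(Y, ℂ) →L[ℂ] ℂ) → (C(Y, ℂ) →L[ℂ] ℂ)) :=
      { toFun := fun B => koopmanDual s ∘ B
        map_add' := fun _ _ => rfl
        map_smul' := fun _ _ => rfl }
    refine convexHull_min ?_ ((convex_convexHull ℝ _).linear_preimage L) hB
    rintro _ ⟨t, rfl⟩
    refine subset_convexHull ℝ _ ⟨s * t, ?_⟩
    funext μ
    ext f
    change μ (koopman (s * t) f) = μ (koopman t (koopman s f))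
    rw [koopman_koopman]
  let L : ((C(Y, ℂ) →L[ℂ] ℂ) → (C(Y, ℂ) →L[ℂ] ℂ)) →ₗ[ℝ]
      ((C(Y, ℂ) →L[ℂ] ℂ) → (C(Y, ℂ) →L[ℂ] ℂ)) := LinearMap.funLeft ℝ _ B
  refine convexHull_min ?_ ((convex_convexHull ℝ _).linear_preimage L) hA
  rintro _ ⟨s, rfl⟩
  exact hleft s B hB

variable [CompactSpace Y]

theorem tendsto_wstarTop {ι : Type*} {l : Filter ι} {g : ι → C(Y, ℂ) →L[ℂ] ℂ}
    {ν : C(Y, ℂ) →L[ℂ] ℂ} :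
    Tendsto g l (@nhds _ (wstarTop Y) ν) ↔ ∀ f, Tendsto (fun i => g i f) l (𝓝 (ν f)) := by
  rw [wstarTop, nhds_induced, tendsto_comap_iff, tendsto_pi_nhds]
  rfl

theorem tendsto_piWstar {ι : Type*} {l : Filter ι}
    {g : ι → (C(Y, ℂ) →L[ℂ] ℂ) → (C(Y, ℂ) →L[ℂ] ℂ)}
    {R : (C(Y, ℂ) →L[ℂ] ℂ) → (C(Y, ℂ) →L[ℂ] ℂ)} :
    Tendsto g l (@nhds _ (piWstar Y) R) ↔
      ∀ μ f, Tendsto (fun i => g i μ f) l (𝓝 (R μ f)) := by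
  let _ := wstarTop Y
  rw [piWstar, tendsto_pi_nhds]
  exact forall_congr' fun μ => tendsto_wstarTop

theorem norm_koopman_apply_le (s : G) (f : C(Y, ℂ)) : ‖koopman s f‖ ≤ ‖f‖ :=
  (ContinuousMap.norm_le _ (norm_nonneg f)).2 fun y => f.norm_coe_le_norm (s • y)

theorem norm_apply_le_of_mem_koopmanHull {A : (C(Y, ℂ) →L[ℂ] ℂ) → (C(Y, ℂ) →L[ℂ] ℂ)}
    (hA : A ∈ koopmanHull Y G) (μ : C(Y, ℂ) →L[ℂ] ℂ) : ‖A μ‖ ≤ ‖μ‖ := by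
  have hconv : Convex ℝ {A : (C(Y, ℂ) →L[ℂ] ℂ) → (C(Y, ℂ) →L[ℂ] ℂ) | ‖A μ‖ ≤ ‖μ‖} := by
    have h : {A : (C(Y, ℂ) →L[ℂ] ℂ) → (C(Y, ℂ) →L[ℂ] ℂ) | ‖A μ‖ ≤ ‖μ‖} =
        LinearMap.proj (R := ℝ) (φ := fun _ : C(Y, ℂ) →L[ℂ] ℂ => C(Y, ℂ) →L[ℂ] ℂ) μ ⁻¹'
          Metric.closedBall 0 ‖μ‖ := by
      ext A
      simp
    rw [h]
    exact (convex_closedBall _ _).linear_preimage _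
  refine convexHull_min ?_ hconv hA
  rintro _ ⟨s, rfl⟩
  refine ContinuousLinearMap.opNorm_le_bound _ (norm_nonneg μ) fun f => ?_
  exact (μ.le_opNorm _).trans
    (mul_le_mul_of_nonneg_left (norm_koopman_apply_le s f) (norm_nonneg μ))

theorem mem_closure_koopmanHull {U : Ultrafilter (G →₀ ℝ)}
    {A : (G →₀ ℝ) → (C(Y, ℂ) →L[ℂ] ℂ) → (C(Y, ℂ) →L[ℂ] ℂ)}
    {B : (C(Y, ℂ) →L[ℂ] ℂ) → (C(Y, ℂ) →L[ℂ] ℂ)}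
    (hA : ∀ᶠ w in U, A w ∈ @closure _ (piWstar Y) (koopmanHull Y G))
    (hB : ∀ μ f, Tendsto (fun w => A w μ f) U (𝓝 (B μ f))) :
    B ∈ @closure _ (piWstar Y) (koopmanHull Y G) := by
  let _ := piWstar Y
  exact isClosed_closure.mem_of_tendsto (tendsto_piWstar.2 hB) hA

theorem exists_tendsto_koopmanAverage {U : Ultrafilter (G →₀ ℝ)}
    (hU : convexHull ℝ (range fun s => Finsupp.single s (1 : ℝ)) ∈ U) :
    ∃ B : (C(Y, ℂ) →L[ℂ] ℂ) → (C(Y, ℂ) →L[ℂ] ℂ),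
      ∀ μ f, Tendsto (fun w => koopmanAverage (G := G) w μ f) U (𝓝 (B μ f)) := by
  have h : ∀ μ : C(Y, ℂ) →L[ℂ] ℂ, ∃ ν : C(Y, ℂ) →L[ℂ] ℂ,
      ∀ f, Tendsto (fun w => koopmanAverage (G := G) w μ f) U (𝓝 (ν f)) := by
    intro μ
    have hmem : WeakDual.toStrongDual ⁻¹' Metric.closedBall (0 : C(Y, ℂ) →L[ℂ] ℂ) ‖μ‖ ∈
        U.map fun w => StrongDual.toWeakDual (koopmanAverage (G := G) w μ) :=
      Ultrafilter.mem_map.2 <| mem_of_superset hU fun w hw => by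
        simpa using norm_apply_le_of_mem_koopmanHull (koopmanAverage_mem hw) μ
    obtain ⟨ν, -, hν⟩ := (WeakDual.isCompact_closedBall (0 : C(Y, ℂ) →L[ℂ] ℂ)
      ‖μ‖).ultrafilter_le_nhds' _ hmem
    exact ⟨WeakDual.toStrongDual ν, fun f => ((WeakDual.eval_continuous f).tendsto ν).comp hν⟩
  choose B hB using h
  exact ⟨B, hB⟩

/-- The real part of a matrix coefficient of the Koopman representation, as a bounded
continuous function. -/
noncomputable def koopmanCoeff (μ : C(Y, ℂ) →L[ℂ] ℂ) (f : C(Y, ℂ)) : G →ᵇ ℝ :=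
  BoundedContinuousFunction.ofNormedAddCommGroup (fun s => (μ (koopman s f)).re)
    (by
      have : Continuous fun s : G => koopman s f :=
        (ContinuousMap.curry ⟨fun p : G × Y => f (p.1 • p.2), by fun_prop⟩).continuous
      fun_prop)
    (‖μ‖ * ‖f‖) fun s => (Complex.abs_re_le_norm _).trans ((μ.le_opNorm _).trans
      (mul_le_mul_of_nonneg_left (norm_koopman_apply_le s f) (norm_nonneg μ)))

@[simp]
theorem koopmanCoeff_apply (μ : C(Y, ℂ) →L[ℂ] ℂ) (f : C(Y, ℂ)) (s : G) :
    koopmanCoeff μ f s = (μ (koopman s f)).re := rfl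

/-- A real function restricted to an orbit, as a bounded continuous function on the semigroup. -/
noncomputable def orbitFun (x : Y) : C(Y, ℝ) →ₗ[ℝ] (G →ᵇ ℝ) where
  toFun f := (BoundedContinuousFunction.mkOfCompact f).compContinuous
    ⟨fun s => s • x, continuous_id.smul continuous_const⟩
  map_add' _ _ := rfl
  map_smul' _ _ := rfl

@[simp]
theorem orbitFun_apply (x : Y) (f : C(Y, ℝ)) (s : G) : orbitFun x f s = f (s • x) := rfl

variable [Semigroup G] [IsScalarTower G G Y]

theorem comp_mem_closure_koopmanHull {U V : Ultrafilter (G →₀ ℝ)}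
    {P B : (C(Y, ℂ) →L[ℂ] ℂ) → (C(Y, ℂ) →L[ℂ] ℂ)}
    (hU : convexHull ℝ (range fun s => Finsupp.single s (1 : ℝ)) ∈ U)
    (hV : convexHull ℝ (range fun s => Finsupp.single s (1 : ℝ)) ∈ V)
    (hP : ∀ μ f, Tendsto (fun w => koopmanAverage (G := G) w μ f) U (𝓝 (P μ f)))
    (hB : ∀ μ f, Tendsto (fun w => koopmanAverage (G := G) w μ f) V (𝓝 (B μ f))) :
    P ∘ B ∈ @closure _ (piWstar Y) (koopmanHull Y G) := by
  refine mem_closure_koopmanHull (U := U) (A := fun w => koopmanAverage w ∘ B) ?_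
    fun μ f => hP (B μ) f
  filter_upwards [hU] with w hw
  refine mem_closure_koopmanHull (U := V) (A := fun v => koopmanAverage w ∘ koopmanAverage v) ?_
    fun μ f => ?_
  · filter_upwards [hV] with v hv
    exact @subset_closure _ (piWstar Y) _ _
      (comp_mem_koopmanHull (koopmanAverage_mem hw) (koopmanAverage_mem hv))
  · simp only [Function.comp_apply, koopmanAverage_apply w]
    exact tendsto_finsetSum _ fun s _ => (hB μ (koopman s f)).const_mul _

/-- In a weak* mean ergodic system, two limits of convex combinations with invariant range agree. -/
theorem WStarMeanErgodic.eq_of_invariant (herg : WStarMeanErgodic Y G)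
    {P Q : (C(Y, ℂ) →L[ℂ] ℂ) → (C(Y, ℂ) →L[ℂ] ℂ)}
    (hP : P ∈ @closure _ (piWstar Y) (koopmanHull Y G))
    (hQ : Q ∈ @closure _ (piWstar Y) (koopmanHull Y G))
    (hPinv : ∀ μ (s : G), koopmanDual s (P μ) = P μ)
    (hQinv : ∀ μ (s : G), koopmanDual s (Q μ) = Q μ) : P = Q := by
  funext μ
  obtain ⟨ν, hν⟩ := herg (⊤ : Filter (ULift Bool)) inferInstance
    (fun i => bif i.down then P else Q) (by rintro ⟨_ | _⟩ <;> assumption)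
    (fun μ s => tendsto_wstarTop.2 fun f => by
      refine tendsto_const_nhds.congr fun i => ?_
      rcases i with ⟨_ | _⟩ <;> simp [hPinv, hQinv]) μ
  have key : ∀ i : ULift Bool, ∀ f, (bif i.down then P else Q) μ f = ν f := by
    intro i f
    have := (tendsto_wstarTop.1 hν f).mono_left (le_top : pure i ≤ ⊤)
    exact tendsto_nhds_unique (tendsto_pure_nhds _ i) this
  ext f
  exact (key ⟨true⟩ f).trans (key ⟨false⟩ f).symm

end Averages

section Measures

variable {Y : Type*} [TopologicalSpace Y] [CompactSpace Y] [MeasurableSpace Y] [BorelSpace Y]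

/-- Integration against a finite measure as a functional on complex continuous functions. -/
noncomputable def integralFunctional (μ : Measure Y) [IsFiniteMeasure μ] : C(Y, ℂ) →L[ℂ] ℂ :=
  LinearMap.mkContinuous
    { toFun := fun f => ∫ y, f y ∂μ
      map_add' := fun f g => integral_add
        (f.continuous.integrable_of_hasCompactSupport (.of_compactSpace _))
        (g.continuous.integrable_of_hasCompactSupport (.of_compactSpace _))
      map_smul' := fun c f => integral_const_mul c _ }
    (μ.real univ) fun f => by
      rw [mul_comm]
      exact norm_integral_le_of_norm_le_const (ae_of_all _ f.norm_coe_le_norm)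

theorem re_integralFunctional_apply (μ : Measure Y) [IsFiniteMeasure μ] (f : C(Y, ℂ)) :
    (integralFunctional μ f).re = ∫ y, (f y).re ∂μ :=
  (integral_re (f.continuous.integrable_of_hasCompactSupport (.of_compactSpace _))).symm

variable [T2Space Y]

theorem ext_of_forall_integral_continuousMap_eq {μ ν : Measure Y} [μ.Regular] [ν.Regular]
    (h : ∀ f : C(Y, ℝ), ∫ y, f y ∂μ = ∫ y, f y ∂ν) : μ = ν :=
  Measure.ext_of_integral_eq_on_compactlySupported fun f => h f.toContinuousMap

/-- A positive functional on the continuous functions on a compact space is represented by a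
regular measure. -/
theorem exists_regular_integral_eq (Λ : C(Y, ℝ) →ₗ[ℝ] ℝ)
    (hΛ : ∀ f : C(Y, ℝ), (∀ y, 0 ≤ f y) → 0 ≤ Λ f) :
    ∃ μ : Measure Y, μ.Regular ∧ IsFiniteMeasure μ ∧ ∀ f : C(Y, ℝ), ∫ y, f y ∂μ = Λ f := by
  let L : C_c(Y, ℝ) →ₚ[ℝ] ℝ := PositiveLinearMap.mk₀
    { toFun := fun f => Λ f.toContinuousMap
      map_add' := fun f g => Λ.map_add f.toContinuousMap g.toContinuousMap
      map_smul' := fun c f => Λ.map_smul c f.toContinuousMap }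
    fun f hf => hΛ _ fun y => hf y
  refine ⟨RealRMK.rieszMeasure L, inferInstance, inferInstance, fun f => ?_⟩
  exact RealRMK.integral_rieszMeasure L (CompactlySupportedContinuousMap.continuousMapEquiv f)

theorem measure_compl_eq_zero_of_integral_eq_zero {μ : Measure Y} [μ.Regular] [IsFiniteMeasure μ]
    {M : Set Y} (hM : IsClosed M)
    (h : ∀ f : C(Y, ℝ), (∀ y ∈ M, f y = 0) → ∫ y, f y ∂μ = 0) : μ Mᶜ = 0 := by
  rw [hM.isOpen_compl.measure_eq_iSup_isCompact]
  simp only [ENNReal.iSup_eq_zero]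
  intro C hCM hC
  obtain ⟨f, hfM, hfC, hf⟩ := exists_continuous_zero_one_of_isClosed hM hC.isClosed
    (disjoint_compl_right.mono_right hCM)
  have hint : Integrable f μ := f.continuous.integrable_of_hasCompactSupport (.of_compactSpace _)
  have h0 : f =ᵐ[μ] 0 :=
    (integral_eq_zero_iff_of_nonneg (fun y => (hf y).1) hint).1 (h f fun y hy => hfM hy)
  refine measure_mono_null (fun y hy => ?_) (ae_iff.1 h0)
  simp [hfC hy]

theorem map_eq_of_integral_comp_eq {μ : Measure Y} [μ.Regular] [IsFiniteMeasure μ]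
    {φ : C(Y, Y)} (h : ∀ f : C(Y, ℝ), ∫ y, f (φ y) ∂μ = ∫ y, f y ∂μ) : μ.map φ = μ := by
  have := Measure.InnerRegularCompactLTTop.map_of_continuous (μ := μ) φ.continuous
  refine ext_of_forall_integral_continuousMap_eq fun f => ?_
  rw [integral_map φ.continuous.aemeasurable f.continuous.aestronglyMeasurable, h]

end Measures

/-- In a weak* mean ergodic system, an invariant probability measure on an orbit closure is given
by averaging along the orbit with respect to any left invariant mean. -/
theorem WStarMeanErgodic.integral_eq_mean {K S : Type*} [TopologicalSpace K] [CompactSpace K]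
    [T2Space K] [MeasurableSpace K] [BorelSpace K] [Semigroup S] [TopologicalSpace S] [SMul S K]
    [IsScalarTower S S K] [ContinuousSMul S K] (herg : WStarMeanErgodic K S)
    {m : (S →ᵇ ℝ) →ₗ[ℝ] ℝ} (hpos : ∀ f : S →ᵇ ℝ, (∀ t, 0 ≤ f t) → 0 ≤ m f) (hone : m 1 = 1)
    (hinv : ∀ (s : S) (f g : S →ᵇ ℝ), (∀ t, g t = f (s * t)) → m g = m f)
    {x : K} {μ : Measure K} [IsProbabilityMeasure μ]
    (hμ : ∀ s : S, μ.map (fun y => s • y) = μ)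
    (hμx : μ (closure (range fun s : S => s • x))ᶜ = 0) (f : C(K, ℝ)) :
    ∫ y, f y ∂μ = m (orbitFun x f) := by
  have hint : ∀ f : C(K, ℝ), Integrable f μ := fun f =>
    f.continuous.integrable_of_hasCompactSupport (.of_compactSpace _)
  obtain ⟨U, hU, hUm⟩ := exists_ultrafilter_tendsto_average
    (fun s : S => (BoundedContinuousFunction.evalCLM ℝ s : (S →ᵇ ℝ) →L[ℝ] ℝ).toLinearMap) m 1
    (fun _ => rfl) hone hpos
  obtain ⟨P, hP⟩ := exists_tendsto_koopmanAverage (Y := K) hU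
  have hPre : ∀ ν f, (P ν f).re = m (koopmanCoeff ν f) := by
    intro ν f
    refine tendsto_nhds_unique ((Complex.continuous_re.tendsto _).comp (hP ν f)) ?_
    refine (hUm (koopmanCoeff ν f)).congr fun w => ?_
    simp [re_koopmanAverage_apply]
  have hPinv : ∀ ν (s : S), koopmanDual s (P ν) = P ν := by
    intro ν s
    refine eq_of_forall_re_eq fun f => ?_
    rw [koopmanDual_apply, hPre, hPre]
    refine hinv s _ _ fun t => ?_
    simp only [koopmanCoeff_apply, koopman_koopman]
  have hPmem : P ∈ @closure _ (piWstar K) (koopmanHull K S) := by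
    refine mem_closure_koopmanHull (U := U) ?_ hP
    filter_upwards [hU] with w hw
    exact @subset_closure _ (piWstar K) _ _ (koopmanAverage_mem hw)
  obtain ⟨V, hV, hVm⟩ := exists_ultrafilter_tendsto_average
    (fun s : S => (ContinuousMap.evalCLM ℝ (s • x) : C(K, ℝ) →L[ℝ] ℝ).toLinearMap)
    { toFun := fun f => ∫ y, f y ∂μ
      map_add' := fun f g => integral_add (hint f) (hint g)
      map_smul' := fun c f => integral_const_mul c _ } 1
    (fun _ => rfl) (by simp) (by
      intro f hf
      refine integral_nonneg_of_ae ?_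
      have hcl : ∀ y ∈ closure (range fun s : S => s • x), 0 ≤ f y :=
        closure_minimal (by rintro _ ⟨s, rfl⟩; exact hf s)
          (isClosed_le continuous_const f.continuous)
      exact measure_mono_null (fun y hy hyM => hy (hcl y hyM)) hμx)
  obtain ⟨B, hB⟩ := exists_tendsto_koopmanAverage (Y := K) hV
  have hBx : B (ContinuousMap.evalCLM ℂ x) = integralFunctional μ := by
    refine eq_of_forall_re_eq fun f => ?_
    rw [re_integralFunctional_apply]
    refine tendsto_nhds_unique ((Complex.continuous_re.tendsto _).comp (hB _ f)) ?_
    refine (hVm ⟨fun y => (f y).re, by fun_prop⟩).congr fun w => ?_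
    simp [re_koopmanAverage_apply]
  have hPB : P ∘ B = P := herg.eq_of_invariant (comp_mem_closure_koopmanHull hU hV hP hB) hPmem
    (fun ν s => hPinv (B ν) s) hPinv
  let fC : C(K, ℂ) := ⟨fun y => (f y : ℂ), by fun_prop⟩
  have hkey : m (koopmanCoeff (integralFunctional μ) fC) =
      m (koopmanCoeff (ContinuousMap.evalCLM ℂ x) fC) := by
    rw [← hPre, ← hPre, ← hBx]
    exact congrArg (fun ν => (ν fC).re) (congrFun hPB (ContinuousMap.evalCLM ℂ x))
  have hleft : (koopmanCoeff (integralFunctional μ) fC : S →ᵇ ℝ) = (∫ y, f y ∂μ) • 1 := by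
    ext s
    rw [koopmanCoeff_apply, re_integralFunctional_apply]
    have hmap := integral_map (μ := μ) (φ := fun y : K => s • y) (f := f)
      (by fun_prop) f.continuous.aestronglyMeasurable
    rw [hμ] at hmap
    simp [hmap, fC]
  have hright : koopmanCoeff (ContinuousMap.evalCLM ℂ x) fC = orbitFun (G := S) x f := by
    ext s
    simp [fC]
  rwa [hleft, hright, map_smul, hone, smul_eq_mul, mul_one] at hkey

/-- If `(K;S)` is weak* mean ergodic with `S` left amenable,
then every orbit closure `M = cl(Sx)` is a nonempty closed `S`-invariant set
and carries exactly one `S`-invariant regular Borel probability measure. -/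
theorem orbitClosure_uniquelyErgodic
    (hleftc : ∀ s : S, Continuous fun t : S => s * t)
    (hrightc : ∀ s : S, Continuous fun t : S => t * s)
    (hamen : LeftAmenable S)
    (herg : WStarMeanErgodic K S) :
    ∀ x : K,
      (closure (range fun s : S => s • x)).Nonempty ∧
      IsClosed (closure (range fun s : S => s • x)) ∧
      (∀ s : S, ∀ y ∈ closure (range fun s : S => s • x),
        s • y ∈ closure (range fun s : S => s • x)) ∧
      (∃! μ : Measure K, μ.Regular ∧ IsProbabilityMeasure μ ∧
        (∀ s : S, Measure.map (fun y => s • y) μ = μ) ∧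
        μ (closure (range fun s : S => s • x))ᶜ = 0) := by
  intro x
  set M := closure (range fun s : S => s • x)
  have hsM : ∀ s : S, s • x ∈ M := fun s => subset_closure ⟨s, rfl⟩
  obtain ⟨m, hpos, hone, hinv⟩ := hamen
  refine ⟨(range_nonempty _).closure, isClosed_closure, fun s y hy => ?_, ?_⟩
  · refine map_mem_closure (continuous_const_smul s) hy ?_
    rintro _ ⟨t, rfl⟩
    exact ⟨s * t, smul_assoc s t x⟩
  obtain ⟨μ, hreg, hfin, hμ⟩ := exists_regular_integral_eq (m ∘ₗ orbitFun (G := S) x)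
    fun f hf => hpos _ fun s => hf (s • x)
  simp only [LinearMap.comp_apply] at hμ
  have hprob : IsProbabilityMeasure μ := by
    have h1 := hμ 1
    have h2 : orbitFun (G := S) x 1 = 1 := rfl
    rw [h2, hone] at h1
    rw [isProbabilityMeasure_iff_real]
    simpa using h1
  refine ⟨μ, ⟨hreg, hprob, fun s => ?_, ?_⟩, ?_⟩
  · refine map_eq_of_integral_comp_eq (φ := ⟨fun y => s • y, continuous_const_smul s⟩) fun f => ?_
    rw [hμ f]
    refine (hμ (f.comp ⟨fun y => s • y, continuous_const_smul s⟩)).trans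
      (hinv s _ _ fun t => ?_)
    simp only [orbitFun_apply, ContinuousMap.comp_apply, ContinuousMap.coe_mk]
    rw [← smul_assoc, smul_eq_mul]
  · refine measure_compl_eq_zero_of_integral_eq_zero isClosed_closure fun f hf => ?_
    have h0 : orbitFun (G := S) x f = 0 := by
      ext s
      exact hf _ (hsM s)
    rw [hμ, h0, map_zero]
  · rintro ν ⟨hνreg, hνprob, hνinv, hνM⟩
    refine ext_of_forall_integral_continuousMap_eq fun f => ?_
    rw [hμ, herg.integral_eq_mean hpos hone hinv hνinv hνM]

end Stmt19
end
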